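/- arXiv:2203.06236 — 6 statements merged into one kernel-verified Lean document; each statement's English description precedes it below -/
import Mathlib

section
/- Let a<b be real numbers and let w be a nonnegative integer. If q ∈ C^{w+1}(ℝ), then for every x ∈ ℝ one has Σ_{n∈ℤ} ω_{[a,b]}(x+n) q(x+n) = ∫_a^b q(y) dy + Σ_{j=0}^{w} ( q^{(j)}(b) B_{j+1}(x−b) − q^{(j)}(a) B_{j+1}(x−a) ) − ∫_a^b q^{(w+1)}(y) B_{w+1}(x−y) dy, the series on the left having only finitely many nonzero terms. -/
open scoped Real
open MeasureTheory

/-- The periodized Bernoulli polynomial `B_n`: the 1-periodic function that on `(0,1)`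
equals the classical Bernoulli polynomial of degree `n` divided by `n!`, regularized at
integer points by the average of the one-sided limits. -/
noncomputable def perB (n : ℕ) (x : ℝ) : ℝ :=
  if Int.fract x = 0 then
    ((Polynomial.aeval (0 : ℝ) (Polynomial.bernoulli n)) +
      (Polynomial.aeval (1 : ℝ) (Polynomial.bernoulli n))) / (2 * n.factorial)
  else (Polynomial.aeval (Int.fract x) (Polynomial.bernoulli n)) / n.factorial

/-- The weight `ω_{[a,b]}`. -/
noncomputable def omegaI (a b x : ℝ) : ℝ :=
  if x < a ∨ b < x then 0 else if x = a ∨ x = b then 1 / 2 else 1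

lemma intervalIntegrable_of_measurable_of_abs_le {f : ℝ → ℝ} (hf : Measurable f) {C : ℝ}
    (hC : ∀ y, |f y| ≤ C) (a b : ℝ) : IntervalIntegrable f volume a b :=
  (intervalIntegrable_const (c := C)).mono_fun' hf.aestronglyMeasurable
    (Filter.Eventually.of_forall hC)

lemma perB_of_fract_ne_zero (n : ℕ) {x : ℝ} (hx : Int.fract x ≠ 0) :
    perB n x = bernoulliFun n (Int.fract x) / n.factorial := by
  simp [perB, hx, bernoulliFun, Polynomial.eval_map_algebraMap]

lemma perB_of_fract_eq_zero (n : ℕ) {x : ℝ} (hx : Int.fract x = 0) :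
    perB n x = (bernoulliFun n 0 + bernoulliFun n 1) / (2 * n.factorial) := by
  simp only [perB, hx, bernoulliFun, Polynomial.eval_map_algebraMap, if_true]

lemma perB_eq_bernoulliFun_fract {n : ℕ} (hn : n ≠ 1) (x : ℝ) :
    perB n x = bernoulliFun n (Int.fract x) / n.factorial := by
  by_cases hx : Int.fract x = 0
  · rw [perB_of_fract_eq_zero n hx, hx, bernoulliFun_endpoints_eq_of_ne_one hn]
    have : (n.factorial : ℝ) ≠ 0 := by positivity
    field_simp
    ring
  · exact perB_of_fract_ne_zero n hx

lemma continuous_perB {n : ℕ} (hn : n ≠ 1) : Continuous (perB n) := by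
  have h : Continuous (bernoulliFun n ∘ Int.fract) :=
    ContinuousOn.comp_fract'' (continuous_bernoulliFun n).continuousOn
      (bernoulliFun_endpoints_eq_of_ne_one hn).symm
  exact (h.div_const (n.factorial : ℝ)).congr fun x => (perB_eq_bernoulliFun_fract hn x).symm

lemma measurable_perB (n : ℕ) : Measurable (perB n) := by
  have h : Measurable fun x : ℝ => if Int.fract x = 0
      then (bernoulliFun n 0 + bernoulliFun n 1) / (2 * n.factorial)
      else bernoulliFun n (Int.fract x) / n.factorial :=
    Measurable.ite (measurable_fract (measurableSet_singleton 0)) measurable_const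
      (((continuous_bernoulliFun n).measurable.comp measurable_fract).div_const _)
  convert h using 2 with x
  split_ifs with hx
  · exact perB_of_fract_eq_zero n hx
  · exact perB_of_fract_ne_zero n hx

lemma exists_abs_perB_le (n : ℕ) : ∃ C, ∀ x, |perB n x| ≤ C := by
  obtain ⟨C, hC⟩ := isCompact_Icc.exists_bound_of_continuousOn
    (continuous_bernoulliFun n).continuousOn (s := Set.Icc (0 : ℝ) 1)
  refine ⟨max (|(bernoulliFun n 0 + bernoulliFun n 1) / (2 * n.factorial)|)
    (C / n.factorial), fun x => ?_⟩
  by_cases hx : Int.fract x = 0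
  · rw [perB_of_fract_eq_zero n hx]
    exact le_max_left _ _
  · rw [perB_of_fract_ne_zero n hx, abs_div, Nat.abs_cast]
    refine le_max_of_le_right ?_
    gcongr
    exact hC _ ⟨Int.fract_nonneg x, (Int.fract_lt_one x).le⟩

lemma intervalIntegrable_perB_sub (n : ℕ) (x a b : ℝ) :
    IntervalIntegrable (fun y => perB n (x - y)) volume a b := by
  obtain ⟨C, hC⟩ := exists_abs_perB_le n
  exact intervalIntegrable_of_measurable_of_abs_le
    ((measurable_perB n).comp (measurable_const.sub measurable_id)) (fun y => hC _) a b

lemma hasDerivAt_perB (n : ℕ) {x : ℝ} (hx : Int.fract x ≠ 0) :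
    HasDerivAt (perB (n + 1)) (perB n x) x := by
  have hd : HasDerivAt (fun t : ℝ => bernoulliFun (n + 1) (t - ⌊x⌋) / (n + 1).factorial)
      (perB n x) x := by
    have h := ((hasDerivAt_bernoulliFun (n + 1) (x - ⌊x⌋)).comp_sub_const x (⌊x⌋ : ℝ)).div_const
      ((n + 1).factorial : ℝ)
    refine h.congr_deriv ?_
    rw [perB_of_fract_ne_zero n hx, Nat.factorial_succ, Int.self_sub_floor, Nat.add_sub_cancel]
    have : (n.factorial : ℝ) ≠ 0 := by positivity
    have : (n + 1 : ℝ) ≠ 0 := by positivity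
    push_cast
    field_simp
  refine hd.congr_of_eventuallyEq ?_
  have hlt : (⌊x⌋ : ℝ) < x := by
    have := (Int.fract_nonneg x).lt_of_ne' hx
    rw [← Int.self_sub_floor] at this
    linarith
  filter_upwards [Ioo_mem_nhds hlt (Int.lt_floor_add_one x)] with t ht
  have hfl : ⌊t⌋ = ⌊x⌋ := Int.floor_eq_iff.2 ⟨ht.1.le, ht.2⟩
  have hft : Int.fract t = t - ⌊x⌋ := by rw [← Int.self_sub_floor, hfl]
  rw [perB_of_fract_ne_zero _ (by rw [hft]; linarith [ht.1]), hft]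

lemma add_perB_one_neg (u : ℝ) : u + perB 1 (-u) = (⌊u⌋ + ⌈u⌉) / 2 := by
  by_cases hu : Int.fract u = 0
  · rw [perB_of_fract_eq_zero 1 (Int.fract_neg_eq_zero.2 hu), bernoulliFun_one, bernoulliFun_one]
    obtain ⟨z, rfl⟩ := Int.fract_eq_zero_iff.1 hu
    simp
    ring
  · rw [perB_of_fract_ne_zero 1 (mt Int.fract_neg_eq_zero.1 hu), Int.fract_neg hu,
      bernoulliFun_one]
    have h : (⌈u⌉ : ℝ) = u + 1 - Int.fract u := (Int.ceil_eq_add_one_sub_fract hu)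
    rw [h, ← Int.self_sub_fract u, Nat.factorial_one, Nat.cast_one]
    ring

lemma omegaI_eq_indicators {a b : ℝ} (hab : a < b) (t : ℝ) :
    omegaI a b t =
      ((if a ≤ t ∧ t ≤ b then 1 else 0) + (if a < t ∧ t < b then 1 else 0)) / 2 := by
  unfold omegaI
  grind

/-- Half-weighted count of the points of `x + ℤ` in `[a, y]`, summed over a larger window. -/
lemma sum_omegaI {a y b : ℝ} (hay : a < y) (hyb : y ≤ b) (x : ℝ) :
    ∑ n ∈ Finset.Icc ⌈a - x⌉ ⌊b - x⌋, omegaI a y (x + n) =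
      perB 1 (x - y) - perB 1 (x - a) + (y - a) := by
  have hclosed : (Finset.Icc ⌈a - x⌉ ⌊b - x⌋).filter (fun n : ℤ => a ≤ x + n ∧ x + n ≤ y) =
      Finset.Icc ⌈a - x⌉ ⌊y - x⌋ := by
    ext n
    simp only [Finset.mem_filter, Finset.mem_Icc, Int.ceil_le, Int.le_floor]
    constructor
    · rintro ⟨_, h⟩
      constructor <;> linarith
    · rintro ⟨h₁, h₂⟩
      refine ⟨⟨?_, ?_⟩, ?_, ?_⟩ <;> linarith
  have hopen : (Finset.Icc ⌈a - x⌉ ⌊b - x⌋).filter (fun n : ℤ => a < x + n ∧ x + n < y) =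
      Finset.Ioo ⌊a - x⌋ ⌈y - x⌉ := by
    ext n
    simp only [Finset.mem_filter, Finset.mem_Icc, Finset.mem_Ioo, Int.ceil_le, Int.le_floor,
      Int.floor_lt, Int.lt_ceil]
    constructor
    · rintro ⟨_, h⟩
      constructor <;> linarith
    · rintro ⟨h₁, h₂⟩
      refine ⟨⟨?_, ?_⟩, ?_, ?_⟩ <;> linarith
  have hcard₁ : ((Finset.Icc ⌈a - x⌉ ⌊y - x⌋).card : ℤ) = ⌊y - x⌋ + 1 - ⌈a - x⌉ := by
    refine Int.card_Icc_of_le _ _ (Int.ceil_le.2 ?_)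
    push_cast
    linarith [Int.lt_floor_add_one (y - x)]
  have hcard₂ : ((Finset.Ioo ⌊a - x⌋ ⌈y - x⌉).card : ℤ) = ⌈y - x⌉ - ⌊a - x⌋ - 1 := by
    refine Int.card_Ioo_of_lt _ _ (Int.floor_lt.2 ?_)
    linarith [Int.le_ceil (y - x)]
  simp_rw [omegaI_eq_indicators hay]
  rw [← Finset.sum_div, Finset.sum_add_distrib, Finset.sum_boole, Finset.sum_boole, hclosed, hopen]
  have h₁ := congrArg (Int.cast : ℤ → ℝ) hcard₁
  have h₂ := congrArg (Int.cast : ℤ → ℝ) hcard₂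
  push_cast at h₁ h₂
  rw [h₁, h₂]
  have hy := add_perB_one_neg (y - x)
  have ha := add_perB_one_neg (a - x)
  rw [neg_sub] at hy ha
  linarith

lemma omegaI_eq_zero_of_notMem {a b x : ℝ} {n : ℤ} (hn : n ∉ Finset.Icc ⌈a - x⌉ ⌊b - x⌋) :
    omegaI a b (x + n) = 0 := by
  rw [Finset.mem_Icc, Int.ceil_le, Int.le_floor] at hn
  refine if_pos ?_
  by_contra! h
  exact hn ⟨by linarith, by linarith⟩

lemma intervalIntegrable_omegaI (a t c d : ℝ) :
    IntervalIntegrable (fun y => omegaI a y t) volume c d := by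
  refine intervalIntegrable_of_measurable_of_abs_le (C := 1) ?_ (fun y => ?_) c d
  · unfold omegaI
    refine Measurable.ite ?_ measurable_const (Measurable.ite ?_ measurable_const measurable_const)
    · exact (MeasurableSet.const _).union measurableSet_Iio
    · exact (MeasurableSet.const _).union (measurableSet_eq_fun measurable_const measurable_id)
  · unfold omegaI
    split_ifs <;> norm_num

lemma integral_deriv_mul_omegaI {a b : ℝ} (hab : a < b) {q q' : ℝ → ℝ}
    (hq : ∀ y, HasDerivAt q (q' y) y) (hq' : Continuous q') (t : ℝ) :
    ∫ y in a..b, q' y * omegaI a y t = omegaI a b t * (q b - q t) := by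
  have hftc : ∀ c d : ℝ, ∫ y in c..d, q' y = q d - q c := fun c d =>
    intervalIntegral.integral_eq_sub_of_hasDerivAt (fun y _ => hq y) (hq'.intervalIntegrable c d)
  have hcongr : ∀ {c d k : ℝ}, c ≤ d → (∀ y, c < y → y < d → omegaI a y t = k) →
      ∫ y in c..d, q' y * omegaI a y t = (q d - q c) * k := by
    intro c d k hcd h
    rw [← hftc c d, ← intervalIntegral.integral_mul_const]
    refine intervalIntegral.integral_congr_uIoo fun y hy => ?_
    rw [Set.uIoo_of_le hcd] at hy
    simp only [h y hy.1 hy.2]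
  rcases lt_trichotomy t a with hta | rfl | hat
  · rw [hcongr (k := 0) hab.le (by unfold omegaI; grind)]
    have : omegaI a b t = 0 := by unfold omegaI; grind
    simp [this]
  · rw [hcongr (k := 1 / 2) hab.le (by unfold omegaI; grind)]
    have : omegaI t b t = 1 / 2 := by unfold omegaI; grind
    rw [this, mul_comm]
  · rcases lt_trichotomy t b with htb | rfl | hbt
    · have hi := fun c d => (intervalIntegrable_omegaI a t c d).continuousOn_mul
        hq'.continuousOn
      rw [← intervalIntegral.integral_add_adjacent_intervals (hi a t) (hi t b),
        hcongr (k := 0) hat.le (by unfold omegaI; grind),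
        hcongr (k := 1) htb.le (by unfold omegaI; grind)]
      have : omegaI a b t = 1 := by unfold omegaI; grind
      simp [this]
    · rw [hcongr (k := 0) hab.le (by unfold omegaI; grind)]
      simp
    · rw [hcongr (k := 0) hab.le (by unfold omegaI; grind)]
      have : omegaI a b t = 0 := by unfold omegaI; grind
      simp [this]

/-- First-order Euler–Maclaurin formula over a window containing all nonzero terms. -/
lemma sum_omegaI_mul {a b : ℝ} (hab : a < b) {q q' : ℝ → ℝ}
    (hq : ∀ y, HasDerivAt q (q' y) y) (hq' : Continuous q') (x : ℝ) :
    ∑ n ∈ Finset.Icc ⌈a - x⌉ ⌊b - x⌋, omegaI a b (x + n) * q (x + n) =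
      (∫ y in a..b, q y) + (q b * perB 1 (x - b) - q a * perB 1 (x - a))
        - ∫ y in a..b, q' y * perB 1 (x - y) := by
  have hsum : ∑ n ∈ Finset.Icc ⌈a - x⌉ ⌊b - x⌋, omegaI a b (x + n) * (q b - q (x + n)) =
      ∫ y in a..b, q' y * (perB 1 (x - y) - perB 1 (x - a) + (y - a)) := by
    simp_rw [← integral_deriv_mul_omegaI hab hq hq']
    rw [← intervalIntegral.integral_finsetSum fun (n : ℤ) _ =>
      (intervalIntegrable_omegaI a (x + n) a b).continuousOn_mul hq'.continuousOn]
    refine intervalIntegral.integral_congr_uIoo fun y hy => ?_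
    rw [Set.uIoo_of_le hab.le] at hy
    simp only [← Finset.mul_sum, sum_omegaI hy.1 hy.2.le]
  have hparts : ∫ y in a..b, (y - a) * q' y = (b - a) * q b - ∫ y in a..b, q y := by
    have h := intervalIntegral.integral_mul_deriv_eq_deriv_mul (a := a) (b := b)
      (fun y _ => (hasDerivAt_id y).sub_const a) (fun y _ => hq y)
      (continuous_const.intervalIntegrable a b) (hq'.intervalIntegrable a b)
    simpa using h
  have hconst : ∫ y in a..b, q' y = q b - q a :=
    intervalIntegral.integral_eq_sub_of_hasDerivAt (fun y _ => hq y) (hq'.intervalIntegrable a b)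
  have hsplit : ∫ y in a..b, q' y * (perB 1 (x - y) - perB 1 (x - a) + (y - a)) =
      (∫ y in a..b, q' y * perB 1 (x - y)) - (q b - q a) * perB 1 (x - a)
        + ((b - a) * q b - ∫ y in a..b, q y) := by
    rw [← hparts, ← hconst, ← intervalIntegral.integral_mul_const,
      ← intervalIntegral.integral_sub, ← intervalIntegral.integral_add]
    · exact intervalIntegral.integral_congr fun y _ => by ring
    · exact ((intervalIntegrable_perB_sub 1 x a b).continuousOn_mul hq'.continuousOn).sub
        ((hq'.mul continuous_const).intervalIntegrable a b)
    · exact Continuous.intervalIntegrable (by fun_prop) a b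
    · exact (intervalIntegrable_perB_sub 1 x a b).continuousOn_mul hq'.continuousOn
    · exact (hq'.mul continuous_const).intervalIntegrable a b
  rw [hsplit] at hsum
  simp_rw [mul_sub] at hsum
  rw [Finset.sum_sub_distrib, ← Finset.sum_mul, sum_omegaI hab le_rfl] at hsum
  linear_combination -hsum

lemma integral_mul_perB_sub {f f' : ℝ → ℝ} (hf : ∀ y, HasDerivAt f (f' y) y)
    (hf' : Continuous f') {n : ℕ} (hn : n ≠ 0) (x a b : ℝ) :
    ∫ y in a..b, f y * perB n (x - y) =
      (∫ y in a..b, f' y * perB (n + 1) (x - y))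
        - (f b * perB (n + 1) (x - b) - f a * perB (n + 1) (x - a)) := by
  have hfc : Continuous f := continuous_iff_continuousAt.2 fun y => (hf y).continuousAt
  have hi₁ := (intervalIntegrable_perB_sub (n + 1) x a b).continuousOn_mul hf'.continuousOn
  have hi₂ := (intervalIntegrable_perB_sub n x a b).continuousOn_mul hfc.continuousOn
  have h := integral_eq_of_hasDerivAt_off_countable (fun y => f y * perB (n + 1) (x - y))
    (fun y => f' y * perB (n + 1) (x - y) - f y * perB n (x - y)) (a := a) (b := b)
    (Set.countable_range fun z : ℤ => x - (z : ℝ))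
    (hfc.mul ((continuous_perB (by lia)).comp
      (continuous_const.sub continuous_id))).continuousOn
    (fun y hy => by
      have hy' : Int.fract (x - y) ≠ 0 := fun h0 => by
        obtain ⟨z, hz⟩ := Int.fract_eq_zero_iff.1 h0
        exact hy.2 ⟨z, by simp [hz]⟩
      have hp := (hasDerivAt_perB n hy').comp_const_sub x y
      exact ((hf y).mul hp).congr_deriv (by ring))
    (hi₁.sub hi₂)
  rw [intervalIntegral.integral_sub hi₁ hi₂] at h
  linarith

theorem stmt0 (a b : ℝ) (hab : a < b) (w : ℕ) (q : ℝ → ℝ)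
    (hq : ContDiff ℝ (w + 1) q) (x : ℝ) :
    {n : ℤ | omegaI a b (x + n) * q (x + n) ≠ 0}.Finite ∧
    ∑' n : ℤ, omegaI a b (x + n) * q (x + n) =
      (∫ y in a..b, q y)
        + (∑ j ∈ Finset.range (w + 1),
            (iteratedDeriv j q b * perB (j + 1) (x - b)
              - iteratedDeriv j q a * perB (j + 1) (x - a)))
        - ∫ y in a..b, iteratedDeriv (w + 1) q y * perB (w + 1) (x - y) := by
  have hzero : ∀ n ∉ Finset.Icc ⌈a - x⌉ ⌊b - x⌋, omegaI a b (x + n) * q (x + n) = 0 :=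
    fun n hn => by rw [omegaI_eq_zero_of_notMem hn, zero_mul]
  refine ⟨(Finset.finite_toSet _).subset fun n hn => by_contra fun h => hn (hzero n h), ?_⟩
  rw [tsum_eq_sum hzero]
  have hderiv : ∀ m < w + 1, ∀ y,
      HasDerivAt (iteratedDeriv m q) (iteratedDeriv (m + 1) q y) y := fun m hm y => by
    rw [iteratedDeriv_succ]
    exact (hq.differentiable_iteratedDeriv m (by exact_mod_cast hm) y).hasDerivAt
  have hcont : ∀ m ≤ w + 1, Continuous (iteratedDeriv m q) := fun m hm =>
    hq.continuous_iteratedDeriv m (by exact_mod_cast hm)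
  clear hq
  induction w with
  | zero =>
    have h := sum_omegaI_mul hab (hderiv 0 (by simp)) (hcont 1 (by simp)) x
    simpa using h
  | succ w ih =>
    rw [ih (fun m hm => hderiv m (by lia)) (fun m hm => hcont m (by lia)),
      Finset.sum_range_succ _ (w + 1),
      integral_mul_perB_sub (hderiv (w + 1) (by lia)) (hcont (w + 2) le_rfl) (by lia)]
    ring
end

section
/- Let a<b be integers, let w be a nonnegative integer and let q ∈ C^{w+1}(ℝ). Then | (1/2)q(a) + q(a+1) + … + q(b−1) + (1/2)q(b) − ∫_a^b q(y) dy − Σ_{j=1}^{⌊(w+1)/2⌋} ( q^{(2j−1)}(b) − q^{(2j−1)}(a) ) B_{2j}(0) | ≤ (π/6) (1/(2π))^w ∫_a^b |q^{(w+1)}(y)| dy. -/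
open scoped Real
open MeasureTheory

theorem perB_zero_right {n : ℕ} (hn : n ≠ 1) :
    perB n 0 = bernoulliFun n 0 / n.factorial := by
  have h := bernoulliFun_endpoints_eq_of_ne_one hn
  simp only [bernoulliFun, Polynomial.eval_map_algebraMap] at h ⊢
  rw [perB, if_pos (Int.fract_zero), h]
  ring

theorem hasDerivAt_bernoulliFun_sub_div_factorial (n : ℕ) (t x : ℝ) :
    HasDerivAt (fun y ↦ bernoulliFun (n + 1) (y - t) / (n + 1).factorial)
      (bernoulliFun n (x - t) / n.factorial) x := by
  have h := ((hasDerivAt_bernoulliFun (n + 1) (x - t)).comp_sub_const x t).div_const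
    ((n + 1).factorial : ℝ)
  convert! h using 1
  have : (n.factorial : ℝ) ≠ 0 := by positivity
  rw [Nat.factorial_succ, Nat.add_sub_cancel]
  push_cast
  field_simp

theorem abs_bernoulliFun_div_factorial_le (w : ℕ) {x : ℝ} (hx : x ∈ Set.Icc (0 : ℝ) 1) :
    |bernoulliFun (w + 1) x / (w + 1).factorial| ≤ π / 6 * (1 / (2 * π)) ^ w := by
  rcases Nat.eq_zero_or_pos w with rfl | hw
  · have hpi := Real.pi_gt_three
    simp only [zero_add, bernoulliFun_one, Nat.factorial_one, Nat.cast_one, div_one, pow_zero,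
      mul_one, abs_le]
    constructor <;> linarith [hx.1, hx.2]
  · have hk : 2 ≤ w + 1 := by omega
    have hbound := (hasSum_one_div_nat_pow_mul_fourier hk hx).norm_le_of_bounded
      (hasSum_zeta_two.mul_left 2) (fun n ↦ by
        rw [norm_mul, mul_comm]
        refine mul_le_mul ?_ ?_ (norm_nonneg _) zero_le_two
        · refine (norm_add_le _ _).trans ?_
          simp only [norm_mul, norm_pow, norm_neg, norm_one, one_pow, one_mul, fourier_apply,
            Circle.norm_coe]
          norm_num
        · rcases Nat.eq_zero_or_pos n with rfl | hn
          · simp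
          · simp only [norm_div, norm_pow, norm_one, Complex.norm_natCast]
            have hn' : (1 : ℝ) ≤ n := by exact_mod_cast hn
            gcongr)
    have hnorm : ‖(-(2 * π * Complex.I) ^ (w + 1) / (w + 1).factorial *
        bernoulliFun (w + 1) x : ℂ)‖ =
        (2 * π) ^ (w + 1) * |bernoulliFun (w + 1) x / (w + 1).factorial| := by
      simp [abs_div, abs_of_pos Real.pi_pos]
      ring
    rw [hnorm] at hbound
    have hpos : (0 : ℝ) < (2 * π) ^ (w + 1) := by positivity
    refine le_of_mul_le_mul_left (hbound.trans_eq ?_) hpos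
    rw [one_div, inv_pow, pow_succ]
    field_simp
    ring

/-- The Euler–Maclaurin formula on an interval of length one. -/
theorem eulerMaclaurin_unit_interval (t : ℝ) (w : ℕ) (q : ℝ → ℝ) (hq : ContDiff ℝ (w + 1) q) :
    (q t + q (t + 1)) / 2 - (∫ y in t..t + 1, q y)
        - ∑ j ∈ Finset.Icc 1 ((w + 1) / 2),
            (iteratedDeriv (2 * j - 1) q (t + 1) - iteratedDeriv (2 * j - 1) q t)
              * perB (2 * j) 0
      = (-1) ^ w * ∫ y in t..t + 1,
          bernoulliFun (w + 1) (y - t) / (w + 1).factorial * iteratedDeriv (w + 1) q y := by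
  have parts (n : ℕ) (hn : ContDiff ℝ (n + 1) q) :
      ∫ y in t..t + 1,
          bernoulliFun (n + 1) (y - t) / (n + 1).factorial * iteratedDeriv (n + 1) q y =
        bernoulliFun (n + 1) 1 / (n + 1).factorial * iteratedDeriv n q (t + 1) -
        bernoulliFun (n + 1) 0 / (n + 1).factorial * iteratedDeriv n q t -
        ∫ y in t..t + 1, bernoulliFun n (y - t) / n.factorial * iteratedDeriv n q y := by
    rw [intervalIntegral.integral_mul_deriv_eq_deriv_mul
      (fun x _ ↦ hasDerivAt_bernoulliFun_sub_div_factorial n t x)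
      (v := iteratedDeriv n q) (fun x _ ↦ ?_)
      (Continuous.intervalIntegrable (by fun_prop) _ _)
      ((hn.continuous_iteratedDeriv (n + 1) (by norm_cast)).intervalIntegrable _ _)]
    · simp
    · rw [iteratedDeriv_succ]
      exact (hn.differentiable_iteratedDeriv' n x).hasDerivAt
  induction w with
  | zero =>
    rw [parts 0 hq]
    simp
    ring
  | succ w ih =>
    have hq' : ContDiff ℝ (w + 1) q := hq.of_le (by norm_cast; omega)
    rw [parts (w + 1) hq, bernoulliFun_endpoints_eq_of_ne_one (by omega), mul_sub,
      pow_succ (-1 : ℝ) w, mul_neg_one, neg_mul, neg_mul, sub_neg_eq_add, ← ih hq']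
    rcases Nat.even_or_odd' w with ⟨m, rfl | rfl⟩
    · rw [show (2 * m + 1 + 1) / 2 = m + 1 by omega, show (2 * m + 1) / 2 = m by omega,
        Finset.sum_Icc_succ_top (by omega), perB_zero_right (n := 2 * (m + 1)) (by omega),
        show 2 * (m + 1) - 1 = 2 * m + 1 by omega, show 2 * (m + 1) = 2 * m + 1 + 1 by omega]
      simp only [even_two, Even.mul_right, Even.neg_pow, one_pow]
      ring
    · rw [show (2 * m + 1 + 1 + 1) / 2 = m + 1 by omega,
        show (2 * m + 1 + 1) / 2 = m + 1 by omega, bernoulliFun_eval_zero,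
        bernoulli_eq_zero_of_odd ⟨m + 1, by ring⟩ (by omega)]
      simp

theorem stmt2 (a b : ℤ) (hab : a < b) (w : ℕ) (q : ℝ → ℝ)
    (hq : ContDiff ℝ (w + 1) q) :
    |(q a + q b) / 2 + (∑ k ∈ Finset.Ioo a b, q k)
        - (∫ y in (a : ℝ)..(b : ℝ), q y)
        - ∑ j ∈ Finset.Icc 1 ((w + 1) / 2),
            (iteratedDeriv (2 * j - 1) q b - iteratedDeriv (2 * j - 1) q a)
              * perB (2 * j) 0|
      ≤ (π / 6) * (1 / (2 * π)) ^ w * ∫ y in (a : ℝ)..(b : ℝ), |iteratedDeriv (w + 1) q y| := by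
  have hcont : Continuous (iteratedDeriv (w + 1) q) :=
    hq.continuous_iteratedDeriv (w + 1) (by norm_cast)
  have unit (t : ℝ) :
      |(q t + q (t + 1)) / 2 - (∫ y in t..t + 1, q y)
        - ∑ j ∈ Finset.Icc 1 ((w + 1) / 2),
            (iteratedDeriv (2 * j - 1) q (t + 1) - iteratedDeriv (2 * j - 1) q t)
              * perB (2 * j) 0|
      ≤ (π / 6) * (1 / (2 * π)) ^ w * ∫ y in t..t + 1, |iteratedDeriv (w + 1) q y| := by
    rw [eulerMaclaurin_unit_interval t w q hq, abs_mul, abs_pow, abs_neg, abs_one, one_pow,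
      one_mul, ← intervalIntegral.integral_const_mul]
    have ht : t ≤ t + 1 := by linarith
    refine (intervalIntegral.abs_integral_le_integral_abs ht).trans ?_
    refine intervalIntegral.integral_mono_on ht
      (Continuous.intervalIntegrable (by fun_prop) _ _)
      (Continuous.intervalIntegrable (by fun_prop) _ _) fun x hx ↦ ?_
    rw [abs_mul]
    exact mul_le_mul_of_nonneg_right
      (abs_bernoulliFun_div_factorial_le w ⟨by linarith [hx.1], by linarith [hx.2]⟩)
      (abs_nonneg _)
  induction b, (show a + 1 ≤ b from hab) using Int.leInduction with
  | base =>
    have hempty : Finset.Ioo a (a + 1) = ∅ := by ext; simp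
    rw [hempty]
    simpa using unit a
  | succ b hb ih =>
    have hinsert : Finset.Ioo a (b + 1) = insert b (Finset.Ioo a b) := by
      ext; simp; omega
    rw [hinsert, Finset.sum_insert (by simp)]
    push_cast
    have hint := intervalIntegral.integral_add_adjacent_intervals
      (hq.continuous.intervalIntegrable (μ := volume) a b)
      (hq.continuous.intervalIntegrable (μ := volume) b (b + 1))
    have hint' := intervalIntegral.integral_add_adjacent_intervals
      (hcont.abs.intervalIntegrable (μ := volume) a b)
      (hcont.abs.intervalIntegrable (μ := volume) b (b + 1))
    rw [← hint, ← hint', mul_add]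
    refine le_trans (le_of_eq ?_) ((abs_add_le _ _).trans (add_le_add (ih hb) (unit b)))
    congr 1
    simp only [sub_mul, Finset.sum_sub_distrib]
    ring
end

section
/- Let φ be a nonnegative, radial, smooth function on ℝ^d with compact support and integral 1, φ_ε(x) = ε^{−d}φ(x/ε). Let P be a convex polytope in ℝ^d, q a smooth function on ℝ^d and Q(x) = q(x)χ_P(x). Then for every ε > 0 and every x ∈ ℝ^d, Σ_{k∈ℤ^d} (φ_ε ∗ Q)(x+k) = Σ_{k∈ℤ^d} φ̂(εk) Q̂(k) e^{2πik·x}, where the first sum is finite and the second converges absolutely; moreover Σ_{k∈ℤ^d} ω_P(x+k) q(x+k) = lim_{ε→0+} Σ_{k∈ℤ^d} φ̂(εk) Q̂(k) e^{2πik·x}. -/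
open scoped Real Topology
open MeasureTheory Filter

/-- The Euclidean unit ball `{ y : |y| ≤ 1 }` in `ℝ^d`. -/
def eball (d : ℕ) : Set (Fin d → ℝ) := {y | ∑ i, (y i) ^ 2 ≤ 1}

/-- The Fourier transform `f̂(ξ) = ∫ f(v) e^{-2πi ξ·v} dv` on `ℝ^d`. -/
noncomputable def ft (d : ℕ) (f : (Fin d → ℝ) → ℂ) (ξ : Fin d → ℝ) : ℂ :=
  ∫ v, f v * Complex.exp (-2 * π * Complex.I * (∑ i, ξ i * v i))

section Lattice

variable {d : ℕ}

/-- The inclusion of the integer lattice `ℤ^d` into `ℝ^d`. -/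
def latticePoint (k : Fin d → ℤ) : Fin d → ℝ := fun i => (k i : ℝ)

lemma finite_latticePoint_mem {S : Set (Fin d → ℝ)} (hS : Bornology.IsBounded S) :
    {k : Fin d → ℤ | latticePoint k ∈ S}.Finite := by
  obtain ⟨R, hR⟩ := hS.subset_closedBall 0
  refine (Set.finite_Icc (fun _ : Fin d => -⌈R⌉) (fun _ => ⌈R⌉)).subset fun k hk => ?_
  have h := hR hk
  rw [mem_closedBall_zero_iff] at h
  have hb : ∀ i, |(k i : ℝ)| ≤ R := fun i => (norm_le_pi_norm (latticePoint k) i).trans h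
  refine ⟨fun i => ?_, fun i => ?_⟩
  · have h1 : -R ≤ k i := (abs_le.1 (hb i)).1
    have h2 := Int.le_ceil R
    have : -((⌈R⌉ : ℤ) : ℝ) ≤ k i := by linarith
    exact_mod_cast this
  · have h1 := (abs_le.1 (hb i)).2
    have h2 := Int.le_ceil R
    have : (k i : ℝ) ≤ (⌈R⌉ : ℤ) := by linarith
    exact_mod_cast this

lemma summable_norm_latticePoint_pow_inv :
    Summable fun k : Fin d → ℤ => ‖latticePoint k‖⁻¹ ^ (d + 1) := by
  obtain ⟨L, _, hL, hmem⟩ : ∃ L : Submodule ℤ (Fin d → ℝ), DiscreteTopology L ∧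
      Module.finrank ℤ L = d ∧ ∀ k : Fin d → ℤ, latticePoint k ∈ L := by
    refine ⟨Submodule.span ℤ (Set.range (Pi.basisFun ℝ (Fin d))), inferInstance, ?_, fun k => ?_⟩
    · rw [ZLattice.rank ℝ]
      simp
    · rw [Module.Basis.mem_span_iff_repr_mem]
      exact fun i => ⟨k i, by simp [latticePoint]⟩
  have h := ZLattice.summable_norm_pow_inv L (d + 1) (by omega)
  have hinj : Function.Injective (fun k : Fin d → ℤ => (⟨latticePoint k, hmem k⟩ : L)) := by
    intro k l hkl
    have := congrArg Subtype.val hkl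
    funext i
    have h2 := congrFun this i
    simpa [latticePoint] using h2
  refine (h.comp_injective hinj).congr fun k => ?_
  simp only [Function.comp_apply, Submodule.coe_norm]

lemma hasSum_setIntegral_unitCube_add {E : Type*} [NormedAddCommGroup E] [NormedSpace ℝ E]
    {h : (Fin d → ℝ) → E} (hh : Integrable h) :
    HasSum (fun k : Fin d → ℤ =>
      ∫ x in {x : Fin d → ℝ | ∀ i, x i ∈ Set.Ioc (0 : ℝ) (0 + 1)}, h (x + latticePoint k))
      (∫ x, h x) := by
  let S : (Fin d → ℤ) → Set (Fin d → ℝ) := fun k =>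
    {x | ∀ i, x i ∈ Set.Ioc (k i : ℝ) (k i + 1)}
  have hSm : ∀ k, MeasurableSet (S k) := fun k => by
    have : S k = Set.univ.pi fun i => Set.Ioc (k i : ℝ) (k i + 1) := by ext; simp [S]
    rw [this]
    exact MeasurableSet.univ_pi fun i => measurableSet_Ioc
  have huniq : ∀ k x, x ∈ S k → k = fun i => ⌈x i⌉ - 1 := fun k x hx => by
    funext i
    have : ⌈x i⌉ = k i + 1 := Int.ceil_eq_iff.2 (by
      push_cast; exact ⟨by linarith [(hx i).1], (hx i).2⟩)
    omega
  have hdisj : Pairwise (Function.onFun Disjoint S) := fun k l hkl =>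
    Set.disjoint_left.2 fun x hx hx' => hkl ((huniq k x hx).trans (huniq l x hx').symm)
  have hU : (⋃ k, S k) = Set.univ := by
    refine Set.eq_univ_of_forall fun x => Set.mem_iUnion.2 ⟨fun i => ⌈x i⌉ - 1, fun i => ?_⟩
    push_cast
    exact ⟨by linarith [Int.ceil_lt_add_one (x i)], by linarith [Int.le_ceil (x i)]⟩
  have H := hasSum_integral_iUnion (μ := volume) (f := h) hSm hdisj hh.integrableOn
  rw [hU, setIntegral_univ] at H
  convert H using 2 with k
  have := (measurePreserving_add_right volume (latticePoint k)).setIntegral_preimage_emb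
    (measurableEmbedding_addRight _) h (S k)
  rw [← this]
  congr 2
  ext x
  simp only [S, latticePoint, Set.mem_ofPred_eq, Set.mem_preimage, Pi.add_apply, Set.mem_Ioc]
  refine forall_congr' fun i => ?_
  constructor <;> rintro ⟨h1, h2⟩ <;> constructor <;> linarith

end Lattice

section Poisson

variable {d : ℕ}

lemma mFourier_coe (n : Fin d → ℤ) (x : Fin d → ℝ) :
    UnitAddTorus.mFourier n (fun i => (x i : UnitAddCircle)) =
      Complex.exp (2 * π * Complex.I * (∑ i, (n i : ℝ) * x i)) := by
  simp only [UnitAddTorus.mFourier, ContinuousMap.coe_mk, fourier_coe_apply]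
  rw [← Complex.exp_sum, Complex.ofReal_sum, Finset.mul_sum]
  congr 1
  refine Finset.sum_congr rfl fun i _ => ?_
  push_cast
  ring

lemma continuous_tsum_add_latticePoint {f : (Fin d → ℝ) → ℂ} (hf : Continuous f)
    (hc : HasCompactSupport f) : Continuous fun x => ∑' k : Fin d → ℤ, f (x + latticePoint k) := by
  have hlf : LocallyFinite fun k : Fin d → ℤ =>
      Function.support fun x => f (x + latticePoint k) := by
    intro x
    refine ⟨Metric.ball x 1, Metric.ball_mem_nhds x one_pos, ?_⟩
    refine (finite_latticePoint_mem
      (hc.isCompact.isBounded.sub (Metric.isBounded_ball (x := x) (r := 1)))).subset ?_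
    rintro k ⟨y, hy, hyb⟩
    exact ⟨y + latticePoint k, subset_tsupport _ hy, y, hyb, by simp⟩
  have : (fun x => ∑' k : Fin d → ℤ, f (x + latticePoint k)) =
      fun x => ∑ᶠ k : Fin d → ℤ, f (x + latticePoint k) := by
    funext x
    exact tsum_eq_finsum (hlf.point_finite x)
  rw [this]
  exact continuous_finsum (fun k => hf.comp (continuous_add_const _)) hlf

/-- Poisson summation for continuous compactly supported functions on `ℝ^d`. -/
lemma tsum_add_latticePoint_eq_tsum_ft {f : (Fin d → ℝ) → ℂ} (hf : Continuous f)
    (hc : HasCompactSupport f) (hs : Summable fun k : Fin d → ℤ => ft d f (latticePoint k))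
    (x : Fin d → ℝ) :
    ∑' k : Fin d → ℤ, f (x + latticePoint k) = ∑' k : Fin d → ℤ, ft d f (latticePoint k) *
      Complex.exp (2 * π * Complex.I * (∑ i, (k i : ℝ) * x i)) := by
  let G : C(Fin d → ℝ, ℂ) :=
    ⟨fun x => ∑' k : Fin d → ℤ, f (x + latticePoint k), continuous_tsum_add_latticePoint hf hc⟩
  let proj : C(Fin d → ℝ, UnitAddTorus (Fin d)) :=
    ⟨Pi.map fun (_ : Fin d) (t : ℝ) => (t : UnitAddCircle),
      Continuous.piMap fun _ => continuous_quotient_mk'⟩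
  have hquot : Topology.IsQuotientMap proj :=
    (IsOpenQuotientMap.piMap fun _ => QuotientAddGroup.isOpenQuotientMap_mk).isQuotientMap
  have hper : ∀ (a : Fin d → ℝ) (m : Fin d → ℤ), G (a + latticePoint m) = G a := fun a m => by
    change ∑' k : Fin d → ℤ, f (a + latticePoint m + latticePoint k) =
      ∑' k : Fin d → ℤ, f (a + latticePoint k)
    rw [← (Equiv.addLeft m).tsum_eq fun k => f (a + latticePoint k)]
    refine tsum_congr fun k => congrArg f ?_
    funext i
    simp [latticePoint, add_assoc]
  have hfac : Function.FactorsThrough G proj := fun a b hab => by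
    have h1 : ∀ i, ∃ n : ℤ, a i + n = b i := fun i => by
      have := QuotientAddGroup.eq.1 (congrFun hab i)
      obtain ⟨n, hn⟩ := AddSubgroup.mem_zmultiples_iff.1 this
      refine ⟨n, ?_⟩
      simp only [zsmul_eq_mul, mul_one] at hn
      linarith
    choose m hm using h1
    rw [← hper a m]
    exact congrArg G (funext hm)
  let g : C(UnitAddTorus (Fin d), ℂ) := hquot.lift G hfac
  have hg : ∀ y : Fin d → ℝ, g (fun i => (y i : UnitAddCircle)) = G y := fun y =>
    DFunLike.congr_fun (hquot.lift_comp G hfac) y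
  have hcoeff : ∀ n, UnitAddTorus.mFourierCoeff g n = ft d f (latticePoint n) := fun n => by
    rw [UnitAddTorus.mFourierCoeff_eq_integral g n 0]
    let h : (Fin d → ℝ) → ℂ := fun v =>
      f v * Complex.exp (-2 * π * Complex.I * (∑ i, (latticePoint n i) * v i))
    have hint : Integrable h := by
      exact Continuous.integrable_of_hasCompactSupport (by fun_prop) hc.mul_right
    have hnorm := hasSum_setIntegral_unitCube_add hint.norm
    have H := hasSum_integral_of_summable_integral_norm
      (μ := volume.restrict {x : Fin d → ℝ | ∀ i, x i ∈ Set.Ioc (0 : ℝ) (0 + 1)})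
      (F := fun (k : Fin d → ℤ) x => h (x + latticePoint k))
      (fun k => (hint.comp_add_right _).integrableOn) hnorm.summable
    rw [ft, (hasSum_setIntegral_unitCube_add hint).unique H]
    refine integral_congr_ae (ae_of_all _ fun y => ?_)
    have hy := hg y
    simp only [smul_eq_mul]
    rw [mFourier_coe, hy]
    change _ * ∑' k : Fin d → ℤ, f (y + latticePoint k) = _
    rw [← tsum_mul_left]
    refine tsum_congr fun k => ?_
    simp only [h]
    rw [mul_comm]
    congr 1
    rw [Complex.exp_eq_exp_iff_exists_int]
    refine ⟨∑ i, n i * k i, ?_⟩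
    simp only [latticePoint, Pi.add_apply, Pi.neg_apply, mul_add, Finset.sum_add_distrib]
    push_cast
    simp only [neg_mul, Finset.sum_neg_distrib]
    ring
  have hsum : Summable (UnitAddTorus.mFourierCoeff g) := by
    simpa only [funext hcoeff] using hs
  have := UnitAddTorus.hasSum_mFourier_series_apply_of_summable hsum
    (fun i => (x i : UnitAddCircle))
  rw [hg] at this
  change G x = _
  rw [← this.tsum_eq]
  simp only [hcoeff, mFourier_coe, smul_eq_mul]

end Poisson

section Fourier

variable {d : ℕ}

lemma norm_ft_exp (ξ v : Fin d → ℝ) :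
    ‖Complex.exp (-2 * π * Complex.I * (∑ i, ξ i * v i))‖ = 1 := by
  rw [show (-2 * π * Complex.I * ((∑ i, ξ i * v i : ℝ) : ℂ)) =
    ((-2 * π * (∑ i, ξ i * v i) : ℝ) : ℂ) * Complex.I by push_cast; ring]
  exact Complex.norm_exp_ofReal_mul_I _

lemma integrable_mul_ft_exp {f : (Fin d → ℝ) → ℂ} (hf : Integrable f) (ξ : Fin d → ℝ) :
    Integrable fun v => f v * Complex.exp (-2 * π * Complex.I * (∑ i, ξ i * v i)) := by
  exact hf.mul_bdd (c := 1) (Continuous.aestronglyMeasurable (by fun_prop))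
    (ae_of_all _ fun v => (norm_ft_exp ξ v).le)

lemma norm_ft_le (f : (Fin d → ℝ) → ℂ) (ξ : Fin d → ℝ) : ‖ft d f ξ‖ ≤ ∫ v, ‖f v‖ := by
  refine (norm_integral_le_integral_norm _).trans_eq ?_
  simp only [norm_mul, norm_ft_exp, mul_one]

lemma ft_convolution {f g : (Fin d → ℝ) → ℂ} (hf : Integrable f) (hg : Integrable g)
    (ξ : Fin d → ℝ) :
    ft d (fun x => ∫ y, f y * g (x - y)) ξ = ft d f ξ * ft d g ξ := by
  have h := integral_convolution (ContinuousLinearMap.mul ℝ ℂ) (integrable_mul_ft_exp hf ξ)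
    (integrable_mul_ft_exp hg ξ)
  rw [ContinuousLinearMap.mul_apply'] at h
  rw [ft, ft, ft, ← h]
  refine integral_congr_ae (ae_of_all _ fun x => ?_)
  simp only [convolution_def, ContinuousLinearMap.mul_apply']
  rw [← integral_mul_const]
  refine integral_congr_ae (ae_of_all _ fun y => ?_)
  have : Complex.exp (-2 * π * Complex.I * (∑ i, ξ i * x i : ℝ)) =
      Complex.exp (-2 * π * Complex.I * (∑ i, ξ i * y i : ℝ)) *
      Complex.exp (-2 * π * Complex.I * (∑ i, ξ i * (x - y) i : ℝ)) := by
    rw [← Complex.exp_add]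
    congr 1
    simp only [Pi.sub_apply, mul_sub, Finset.sum_sub_distrib]
    push_cast
    ring
  simp only
  rw [this]
  ring

lemma ft_inv_smul (f : (Fin d → ℝ) → ℂ) {ε : ℝ} (hε : 0 < ε) (ξ : Fin d → ℝ) :
    ft d (fun y => ((ε ^ d)⁻¹ : ℝ) * f (ε⁻¹ • y)) ξ = ft d f (ε • ξ) := by
  have h := Measure.integral_comp_inv_smul_of_nonneg (volume : Measure (Fin d → ℝ))
    (fun v => f v * Complex.exp (-2 * π * Complex.I * (∑ i, (ε • ξ) i * v i))) hε.le
  rw [Module.finrank_fin_fun] at h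
  have hne : ε ^ d ≠ 0 := (pow_pos hε d).ne'
  rw [ft, ft, ← inv_smul_smul₀ hne (∫ v, f v * _), ← h, ← integral_smul]
  refine integral_congr_ae (ae_of_all _ fun y => ?_)
  simp only [Complex.real_smul, mul_assoc]
  congr 6
  push_cast
  refine Finset.sum_congr rfl fun i _ => ?_
  simp only [Pi.smul_apply, smul_eq_mul]
  push_cast
  have : (ε : ℂ) ≠ 0 := by exact_mod_cast hε.ne'
  field_simp

lemma exists_pow_norm_mul_norm_ft_le {f : (Fin d → ℝ) → ℂ} (hf : ContDiff ℝ (⊤ : ℕ∞) f)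
    (hc : HasCompactSupport f) (n : ℕ) :
    ∃ C : ℝ, ∀ ξ : Fin d → ℝ, ‖ξ‖ ^ n * ‖ft d f ξ‖ ≤ C := by
  let e := EuclideanSpace.equiv (Fin d) ℝ
  have hfe : ContDiff ℝ (⊤ : ℕ∞) (f ∘ e) := hf.comp e.contDiff
  have hce : HasCompactSupport (f ∘ e) := hc.comp_homeomorph e.toHomeomorph
  obtain ⟨C, -, hC⟩ := (FourierTransform.fourier (hce.toSchwartzMap hfe)).decay n 0
  refine ⟨C, fun ξ => ?_⟩
  have h1 := hC (e.symm ξ)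
  rw [norm_iteratedFDeriv_zero, SchwartzMap.fourier_coe, Real.fourier_eq'] at h1
  have h2 : ft d f ξ = ∫ v, Complex.exp ((↑(-2 * π * inner ℝ v (e.symm ξ)) * Complex.I)) •
      hce.toSchwartzMap hfe v := by
    rw [ft, ← (PiLp.volume_preserving_ofLp (Fin d)).integral_comp
      (MeasurableEquiv.toLp 2 (Fin d → ℝ)).symm.measurableEmbedding]
    refine integral_congr_ae (ae_of_all _ fun v => ?_)
    simp only [smul_eq_mul]
    rw [mul_comm]
    congr 1
    congr 1
    simp only [PiLp.inner_apply, e]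
    push_cast
    simp
    ring
  rw [h2]
  refine le_trans ?_ h1
  gcongr
  refine (pi_norm_le_iff_of_nonneg (norm_nonneg _)).2 fun i => ?_
  exact PiLp.norm_apply_le (e.symm ξ) i

end Fourier

section Cone

variable {d : ℕ}

lemma isBounded_sum_sq_le (t : ℝ) :
    Bornology.IsBounded {y : Fin d → ℝ | ∑ i, (y i) ^ 2 ≤ t} := by
  refine (Metric.isBounded_closedBall (x := (0 : Fin d → ℝ)) (r := √t)).subset fun y hy => ?_
  rw [mem_closedBall_zero_iff, pi_norm_le_iff_of_nonneg (Real.sqrt_nonneg t)]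
  intro i
  refine Real.abs_le_sqrt (le_trans ?_ hy)
  exact Finset.single_le_sum (f := fun i => y i ^ 2) (fun i _ => sq_nonneg _) (Finset.mem_univ i)

lemma measurable_sum_sq : Measurable fun y : Fin d → ℝ => ∑ i, (y i) ^ 2 := by fun_prop

lemma measurableSet_eball_pi : MeasurableSet (eball d) :=
  measurableSet_le measurable_sum_sq measurable_const

lemma volume_eball_ne_top : volume (eball d) ≠ ⊤ :=
  (isBounded_sum_sq_le 1).measure_lt_top.ne

lemma volume_eball_ne_zero : volume (eball d) ≠ 0 := by
  have hopen : IsOpen {y : Fin d → ℝ | ∑ i, (y i) ^ 2 < 1} :=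
    isOpen_lt (by fun_prop) continuous_const
  have hpos := hopen.measure_pos volume ⟨0, by simp⟩
  have hsub : {y : Fin d → ℝ | ∑ i, (y i) ^ 2 < 1} ⊆ eball d := fun y hy => by
    simp only [Set.mem_ofPred_eq] at hy
    exact hy.le
  exact (hpos.trans_le (measure_mono hsub)).ne'

open scoped Pointwise in
/-- The part of a cone in the Euclidean ball of radius `√t` has volume proportional to the part in
the unit ball. -/
lemma volume_cone_inter_sum_sq_le (hd : 1 ≤ d) {C : Set (Fin d → ℝ)}
    (hC : ∀ r : ℝ, 0 < r → ∀ y ∈ C, r • y ∈ C) (t : ℝ) :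
    volume (C ∩ {y | ∑ i, (y i) ^ 2 ≤ t}) =
      ENNReal.ofReal (√t ^ d) * volume (C ∩ eball d) := by
  have : NeZero d := ⟨by omega⟩
  rcases le_or_gt t 0 with ht | ht
  · have hsub : C ∩ {y : Fin d → ℝ | ∑ i, (y i) ^ 2 ≤ t} ⊆ {0} := by
      rintro y ⟨-, hy⟩
      have h0 : ∑ i, (y i) ^ 2 = 0 :=
        le_antisymm (le_trans hy ht) (Finset.sum_nonneg fun i _ => sq_nonneg _)
      rw [Finset.sum_eq_zero_iff_of_nonneg fun i _ => sq_nonneg _] at h0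
      exact funext fun i => by simpa using h0 i (Finset.mem_univ i)
    rw [measure_mono_null hsub (measure_singleton 0), Real.sqrt_eq_zero_of_nonpos ht,
      zero_pow (by omega)]
    simp
  · have hs : 0 < √t := Real.sqrt_pos.2 ht
    have hset : C ∩ {y : Fin d → ℝ | ∑ i, (y i) ^ 2 ≤ t} = √t • (C ∩ eball d) := by
      ext y
      rw [Set.mem_smul_set_iff_inv_smul_mem₀ hs.ne']
      have hsum : ∑ i, ((√t)⁻¹ • y) i ^ 2 = t⁻¹ * ∑ i, (y i) ^ 2 := by
        simp only [Pi.smul_apply, smul_eq_mul, mul_pow, inv_pow, Real.sq_sqrt ht.le,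
          ← Finset.mul_sum]
      have hball : ((√t)⁻¹ • y ∈ eball d) ↔ ∑ i, (y i) ^ 2 ≤ t := by
        change ∑ i, ((√t)⁻¹ • y) i ^ 2 ≤ 1 ↔ _
        rw [hsum, inv_mul_le_iff₀ ht, mul_one]
      refine and_congr ⟨hC _ (inv_pos.2 hs) y, fun h => ?_⟩ hball.symm
      simpa [smul_smul, hs.ne'] using hC _ hs _ h
    rw [hset, Measure.addHaar_smul, Module.finrank_fin_fun, abs_of_nonneg (by positivity)]

lemma map_sum_sq_Ioc (hd : 1 ≤ d) {C : Set (Fin d → ℝ)}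
    (hC : ∀ r : ℝ, 0 < r → ∀ y ∈ C, r • y ∈ C) {a b : ℝ} (hab : a ≤ b) :
    (Measure.map (fun y : Fin d → ℝ => ∑ i, (y i) ^ 2) (volume.restrict C)) (Set.Ioc a b) =
      (ENNReal.ofReal (√b ^ d) - ENNReal.ofReal (√a ^ d)) * volume (C ∩ eball d) := by
  have hmeas (t : ℝ) : MeasurableSet {y : Fin d → ℝ | ∑ i, (y i) ^ 2 ≤ t} :=
    measurableSet_le measurable_sum_sq measurable_const
  have hfin (t : ℝ) : volume.restrict C {y : Fin d → ℝ | ∑ i, (y i) ^ 2 ≤ t} ≠ ⊤ :=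
    ((Measure.restrict_apply_le _ _).trans_lt (isBounded_sum_sq_le t).measure_lt_top).ne
  rw [Measure.map_apply measurable_sum_sq measurableSet_Ioc]
  have hset : (fun y : Fin d → ℝ => ∑ i, (y i) ^ 2) ⁻¹' Set.Ioc a b =
      {y | ∑ i, (y i) ^ 2 ≤ b} \ {y | ∑ i, (y i) ^ 2 ≤ a} := by
    ext y
    simp [and_comm]
  have hsub : {y : Fin d → ℝ | ∑ i, (y i) ^ 2 ≤ a} ⊆ {y | ∑ i, (y i) ^ 2 ≤ b} :=
    fun y hy => le_trans hy hab
  rw [hset, measure_sdiff hsub (hmeas a).nullMeasurableSet (hfin a),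
    Measure.restrict_apply (hmeas a), Measure.restrict_apply (hmeas b), Set.inter_comm _ C,
    Set.inter_comm _ C, volume_cone_inter_sum_sq_le hd hC, volume_cone_inter_sum_sq_le hd hC,
    ENNReal.sub_mul]
  exact fun _ _ => ((measure_mono Set.inter_subset_right).trans_lt
    (isBounded_sum_sq_le 1).measure_lt_top).ne

/-- The integral of a radial function over a cone is the proportion of the unit ball in the cone
times its integral over the whole space. -/
lemma volume_eball_mul_setIntegral_cone (hd : 1 ≤ d) {φ : (Fin d → ℝ) → ℝ} (hφ : Continuous φ)
    (hrad : ∀ x y : Fin d → ℝ, ∑ i, (x i) ^ 2 = ∑ i, (y i) ^ 2 → φ x = φ y)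
    {C : Set (Fin d → ℝ)} (hC : ∀ r : ℝ, 0 < r → ∀ y ∈ C, r • y ∈ C) :
    (volume (eball d)).toReal * ∫ y in C, φ y = (volume (C ∩ eball d)).toReal * ∫ y, φ y := by
  let N : (Fin d → ℝ) → ℝ := fun y => ∑ i, (y i) ^ 2
  let g : ℝ → ℝ := fun t => φ (Pi.single ⟨0, hd⟩ √t)
  have hg : Continuous g := hφ.comp
    ((continuous_single (A := fun _ : Fin d => ℝ) ⟨0, hd⟩).comp Real.continuous_sqrt)
  have hφg : ∀ y, φ y = g (N y) := fun y => hrad _ _ (by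
    symm
    rw [Finset.sum_eq_single ⟨0, hd⟩ (fun i _ hi => by simp [hi]) (by simp), Pi.single_eq_same,
      Real.sq_sqrt (Finset.sum_nonneg fun i _ => sq_nonneg _)])
  have hint : ∀ S : Set (Fin d → ℝ),
      ∫ y in S, φ y = ∫ t, g t ∂(Measure.map N (volume.restrict S)) := fun S => by
    rw [integral_map measurable_sum_sq.aemeasurable hg.aestronglyMeasurable]
    simp only [hφg, N]
  have hmeas : volume (eball d) • Measure.map N (volume.restrict C) =
      volume (C ∩ eball d) • Measure.map N (volume.restrict Set.univ) := by
    refine Measure.ext_of_Ioc' _ _ (fun a b hab => ?_) fun a b hab => ?_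
    · rw [Measure.smul_apply, map_sum_sq_Ioc hd hC hab.le]
      refine ENNReal.mul_ne_top volume_eball_ne_top (ENNReal.mul_ne_top (by finiteness) ?_)
      exact ((measure_mono Set.inter_subset_right).trans_lt volume_eball_ne_top.lt_top).ne
    · rw [Measure.smul_apply, Measure.smul_apply, map_sum_sq_Ioc hd hC hab.le,
        map_sum_sq_Ioc hd (fun _ _ _ _ => Set.mem_univ _) hab.le, Set.univ_inter, smul_eq_mul,
        smul_eq_mul]
      ring
  have h := congrArg (fun μ => ∫ t, g t ∂μ) hmeas
  simp only [integral_smul_measure, ← hint, smul_eq_mul, setIntegral_univ] at h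
  exact h

end Cone

section SolidAngle

variable {d : ℕ}

/-- The cone of directions `y` for which `p - ε y` lies in `P` for all small `ε > 0`. -/
def tangentDirections (P : Set (Fin d → ℝ)) (p : Fin d → ℝ) : Set (Fin d → ℝ) :=
  {y | ∀ᶠ ε : ℝ in 𝓝[>] 0, p - ε • y ∈ P}

lemma smul_mem_tangentDirections (P : Set (Fin d → ℝ)) (p : Fin d → ℝ) (r : ℝ) (hr : 0 < r)
    (y : Fin d → ℝ) (hy : y ∈ tangentDirections P p) : r • y ∈ tangentDirections P p := by
  have ht : Tendsto (fun ε : ℝ => ε * r) (𝓝[>] 0) (𝓝[>] 0) := by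
    refine tendsto_nhdsWithin_iff.2 ⟨?_, ?_⟩
    · refine tendsto_nhdsWithin_of_tendsto_nhds ?_
      simpa using (continuous_mul_const r).tendsto 0
    · filter_upwards [self_mem_nhdsWithin] with ε hε using mul_pos hε hr
  have h := ht.eventually hy
  simpa only [tangentDirections, Set.mem_ofPred_eq, smul_smul] using h

lemma eventually_mem_iff_mem_tangentDirections {P : Set (Fin d → ℝ)} (hconv : Convex ℝ P)
    (hclosed : IsClosed P) (p y : Fin d → ℝ) :
    ∀ᶠ ε : ℝ in 𝓝[>] 0, p - ε • y ∈ P ↔ y ∈ tangentDirections P p := by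
  by_cases hy : y ∈ tangentDirections P p
  · filter_upwards [hy] with ε hε
    simp [hε, hy]
  suffices h : ∀ᶠ ε : ℝ in 𝓝[>] 0, p - ε • y ∉ P by
    filter_upwards [h] with ε hε
    simp [hε, hy]
  by_cases hp : p ∈ P
  · filter_upwards [self_mem_nhdsWithin] with ε₀ (hε₀ : 0 < ε₀) hmem
    refine hy ?_
    filter_upwards [Ioo_mem_nhdsGT hε₀] with ε hε
    have hle : ε / ε₀ ≤ 1 := (div_le_one hε₀).2 hε.2.le
    have h := hconv hp hmem (sub_nonneg.2 hle) (div_nonneg hε.1.le hε₀.le) (by ring)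
    convert h using 1
    ext i
    simp only [Pi.add_apply, Pi.sub_apply, Pi.smul_apply, smul_eq_mul]
    field_simp
    ring
  · refine eventually_nhdsWithin_of_eventually_nhds ?_
    have hcont : Continuous fun ε : ℝ => p - ε • y := by fun_prop
    exact hcont.continuousAt.eventually (hclosed.isOpen_compl.mem_nhds (by simpa using hp))

lemma measurableSet_tangentDirections {P : Set (Fin d → ℝ)} (hconv : Convex ℝ P)
    (hclosed : IsClosed P) (p : Fin d → ℝ) : MeasurableSet (tangentDirections P p) :=
  measurableSet_of_tendsto_indicator (𝓝[>] (0 : ℝ)) (As := fun ε => (fun y => p - ε • y) ⁻¹' P)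
    (fun ε => (hclosed.preimage (by fun_prop)).measurableSet)
    (eventually_mem_iff_mem_tangentDirections hconv hclosed p)

/-- A weighted average of a continuous function cut off to `P`, at scale `ε` around `p`, converges
to the weight of the tangent directions times the value at `p`. -/
lemma tendsto_integral_mul_indicator {P : Set (Fin d → ℝ)} (hconv : Convex ℝ P)
    (hcomp : IsCompact P) {q : (Fin d → ℝ) → ℝ} (hq : Continuous q) {w : (Fin d → ℝ) → ℝ}
    (hw : Integrable w) (p : Fin d → ℝ) :
    Tendsto (fun ε : ℝ => ∫ y, w y * P.indicator q (p - ε • y)) (𝓝[>] 0)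
      (𝓝 ((∫ y in tangentDirections P p, w y) * q p)) := by
  obtain ⟨M, hM⟩ := hcomp.exists_bound_of_continuousOn hq.continuousOn
  have hMind : ∀ v, ‖P.indicator q v‖ ≤ max M 0 := fun v => by
    by_cases hv : v ∈ P
    · rw [Set.indicator_of_mem hv]
      exact (hM v hv).trans (le_max_left _ _)
    · rw [Set.indicator_of_notMem hv, norm_zero]
      exact le_max_right _ _
  rw [← integral_mul_const, ← integral_indicator
    (measurableSet_tangentDirections hconv hcomp.isClosed p)]
  have hmeas : Measurable (P.indicator q) := hq.measurable.indicator hcomp.measurableSet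
  refine tendsto_integral_filter_of_dominated_convergence (fun y => ‖w y‖ * max M 0)
    (.of_forall fun ε => ?_) (.of_forall fun ε => ae_of_all _ fun y => ?_) (hw.norm.mul_const _)
    (ae_of_all _ fun y => ?_)
  · exact hw.aestronglyMeasurable.mul (hmeas.comp (by fun_prop)).aestronglyMeasurable
  · rw [norm_mul]
    exact mul_le_mul_of_nonneg_left (hMind _) (norm_nonneg _)
  · have hev := eventually_mem_iff_mem_tangentDirections hconv hcomp.isClosed p y
    by_cases hy : y ∈ tangentDirections P p
    · rw [Set.indicator_of_mem hy]
      have hq' : Tendsto (fun ε : ℝ => w y * q (p - ε • y)) (𝓝[>] 0) (𝓝 (w y * q p)) := by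
        have hcont : Continuous fun ε : ℝ => w y * q (p - ε • y) := by fun_prop
        simpa using (hcont.tendsto 0).mono_left nhdsWithin_le_nhds
      refine hq'.congr' ?_
      filter_upwards [hev] with ε hε
      rw [Set.indicator_of_mem (hε.2 hy)]
    · rw [Set.indicator_of_notMem hy]
      refine tendsto_const_nhds.congr' ?_
      filter_upwards [hev] with ε hε
      rw [Set.indicator_of_notMem (mt hε.1 hy), mul_zero]

end SolidAngle

section Mollification

variable {d : ℕ}

/-- The convolution `(φ_ε ∗ g)(p)` with the rescaled kernel `φ_ε(y) = ε^{-d} φ(y / ε)`. -/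
noncomputable def mollify (φ g : (Fin d → ℝ) → ℝ) (ε : ℝ) (p : Fin d → ℝ) : ℝ :=
  ∫ y, (ε ^ d)⁻¹ * φ (ε⁻¹ • y) * g (p - y)

lemma mollify_eq_integral_smul (φ g : (Fin d → ℝ) → ℝ) {ε : ℝ} (hε : 0 < ε) (p : Fin d → ℝ) :
    mollify φ g ε p = ∫ y, φ y * g (p - ε • y) := by
  have h := Measure.integral_comp_inv_smul_of_nonneg (volume : Measure (Fin d → ℝ))
    (fun y => φ y * g (p - ε • y)) hε.le
  rw [Module.finrank_fin_fun] at h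
  have hne : ε ^ d ≠ 0 := (pow_pos hε d).ne'
  rw [← inv_smul_smul₀ hne (∫ y, φ y * g (p - ε • y)), ← h, ← integral_smul, mollify]
  refine integral_congr_ae (ae_of_all _ fun y => ?_)
  simp only [smul_inv_smul₀ hε.ne', smul_eq_mul, mul_assoc]

open scoped Pointwise in
lemma mem_add_closedBall_of_mollify_ne_zero {φ q : (Fin d → ℝ) → ℝ} {P : Set (Fin d → ℝ)} {R : ℝ}
    (hR : Function.support φ ⊆ Metric.closedBall 0 R) {ε : ℝ} (hε : 0 < ε) {p : Fin d → ℝ}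
    (h : mollify φ (P.indicator q) ε p ≠ 0) : p ∈ P + Metric.closedBall 0 (ε * R) := by
  rw [mollify_eq_integral_smul φ _ hε] at h
  obtain ⟨y, hy⟩ : ∃ y, φ y * P.indicator q (p - ε • y) ≠ 0 := by
    by_contra! hall
    exact h (by simp [hall])
  have hyP : p - ε • y ∈ P := by
    by_contra hn
    exact hy (by rw [Set.indicator_of_notMem hn, mul_zero])
  have hyR := mem_closedBall_zero_iff.1 (hR (left_ne_zero_of_mul hy))
  refine ⟨p - ε • y, hyP, ε • y, ?_, by simp⟩
  rw [mem_closedBall_zero_iff, norm_smul, Real.norm_of_nonneg hε.le]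
  gcongr

open scoped Pointwise in
lemma finite_add_latticePoint_mem_add_closedBall {P : Set (Fin d → ℝ)}
    (hP : Bornology.IsBounded P) (x : Fin d → ℝ) (r : ℝ) :
    {k : Fin d → ℤ | x + latticePoint k ∈ P + Metric.closedBall 0 r}.Finite := by
  refine (finite_latticePoint_mem (((hP.add (Metric.isBounded_closedBall (x := 0) (r := r))).sub
    (Bornology.isBounded_singleton (x := x))))).subset fun k hk => ?_
  exact ⟨x + latticePoint k, hk, x, rfl, by simp⟩

lemma integrable_indicator_of_isCompact {P : Set (Fin d → ℝ)} (hP : IsCompact P)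
    {q : (Fin d → ℝ) → ℝ} (hq : Continuous q) : Integrable (P.indicator q) :=
  (hq.continuousOn.integrableOn_compact hP).integrable_indicator hP.measurableSet

lemma summable_norm_ft_mul_ft {φ Q : (Fin d → ℝ) → ℂ} (hφ : ContDiff ℝ (⊤ : ℕ∞) φ)
    (hc : HasCompactSupport φ) {ε : ℝ} (hε : 0 < ε) :
    Summable fun k : Fin d → ℤ => ‖ft d φ (ε • latticePoint k) * ft d Q (latticePoint k)‖ := by
  obtain ⟨A, hA⟩ := exists_pow_norm_mul_norm_ft_le hφ hc (d + 1)
  let M := ∫ v, ‖Q v‖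
  refine Summable.of_norm_bounded_eventually
    (summable_norm_latticePoint_pow_inv.mul_left (A * (ε ^ (d + 1))⁻¹ * M)) ?_
  filter_upwards [(Set.finite_singleton (0 : Fin d → ℤ)).compl_mem_cofinite] with k hk
  have hk0 : 0 < ‖latticePoint k‖ := by
    refine norm_pos_iff.2 fun h => hk ?_
    refine funext fun i => ?_
    have := congrFun h i
    simpa [latticePoint] using this
  have h1 := hA (ε • latticePoint k)
  rw [norm_smul, Real.norm_of_nonneg hε.le, mul_pow] at h1
  have h2 : ‖ft d φ (ε • latticePoint k)‖ ≤
      A * (ε ^ (d + 1))⁻¹ * ‖latticePoint k‖⁻¹ ^ (d + 1) := by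
    rw [inv_pow, mul_assoc, ← mul_inv, ← div_eq_mul_inv, le_div_iff₀ (by positivity)]
    linarith
  rw [norm_norm, norm_mul]
  calc _ ≤ A * (ε ^ (d + 1))⁻¹ * ‖latticePoint k‖⁻¹ ^ (d + 1) * M :=
        mul_le_mul h2 (norm_ft_le Q _) (norm_nonneg _) ((norm_nonneg _).trans h2)
    _ = _ := by ring

lemma continuous_mollify {φ g : (Fin d → ℝ) → ℝ} (hφ : Continuous φ) (hc : HasCompactSupport φ)
    (hg : Integrable g) {ε : ℝ} (hε : 0 < ε) : Continuous (mollify φ g ε) := by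
  have hc' : HasCompactSupport fun y => (ε ^ d)⁻¹ * φ (ε⁻¹ • y) :=
    (hc.comp_homeomorph (Homeomorph.smulOfNeZero ε⁻¹ (inv_ne_zero hε.ne'))).mul_left
  exact hc'.continuous_convolution_left (ContinuousLinearMap.mul ℝ ℝ) (by fun_prop)
    hg.locallyIntegrable

lemma hasCompactSupport_mollify_indicator {φ q : (Fin d → ℝ) → ℝ} {P : Set (Fin d → ℝ)}
    (hP : IsCompact P) (hc : HasCompactSupport φ) {ε : ℝ} (hε : 0 < ε) :
    HasCompactSupport (mollify φ (P.indicator q) ε) := by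
  obtain ⟨R, hR⟩ := hc.isCompact.isBounded.subset_closedBall 0
  refine HasCompactSupport.intro (hP.add (isCompact_closedBall 0 (ε * R))) fun p hp => ?_
  by_contra h
  exact hp (mem_add_closedBall_of_mollify_ne_zero ((subset_tsupport φ).trans hR) hε h)

lemma ft_mollify {φ g : (Fin d → ℝ) → ℝ} (hφ : Integrable φ) (hg : Integrable g) {ε : ℝ}
    (hε : 0 < ε) (ξ : Fin d → ℝ) :
    ft d (fun x => (mollify φ g ε x : ℂ)) ξ =
      ft d (fun v => (φ v : ℂ)) (ε • ξ) * ft d (fun v => (g v : ℂ)) ξ := by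
  have hφ' : Integrable fun y => ((ε ^ d)⁻¹ : ℝ) * (φ (ε⁻¹ • y) : ℂ) :=
    ((hφ.comp_smul (inv_ne_zero hε.ne')).ofReal (𝕜 := ℂ)).const_mul _
  have hg' : Integrable fun v => (g v : ℂ) := hg.ofReal
  rw [← ft_inv_smul (fun v => (φ v : ℂ)) hε, ← ft_convolution hφ' hg']
  congr 1
  funext x
  rw [mollify, ← integral_complex_ofReal]
  simp only [Complex.ofReal_mul]

lemma tsum_mollify_eq_tsum_ft {φ q : (Fin d → ℝ) → ℝ} {P : Set (Fin d → ℝ)}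
    (hφ : ContDiff ℝ (⊤ : ℕ∞) φ) (hc : HasCompactSupport φ) (hP : IsCompact P) (hq : Continuous q)
    {ε : ℝ} (hε : 0 < ε) (x : Fin d → ℝ) :
    ∑' k : Fin d → ℤ, (mollify φ (P.indicator q) ε (x + latticePoint k) : ℂ) =
      ∑' k : Fin d → ℤ, ft d (fun v => (φ v : ℂ)) (ε • latticePoint k) *
        ft d (fun v => ((P.indicator q v : ℝ) : ℂ)) (latticePoint k) *
        Complex.exp (2 * π * Complex.I * (∑ i, (k i : ℝ) * x i)) := by
  have hQ := integrable_indicator_of_isCompact hP hq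
  have hft := ft_mollify (hφ.continuous.integrable_of_hasCompactSupport hc) hQ hε
  have hφc : ContDiff ℝ (⊤ : ℕ∞) fun v => (φ v : ℂ) := Complex.ofRealCLM.contDiff.comp hφ
  have hs := (summable_norm_ft_mul_ft (Q := fun v => ((P.indicator q v : ℝ) : ℂ)) hφc
    (hc.comp_left Complex.ofReal_zero) hε).of_norm
  simp only [← hft] at hs ⊢
  exact tsum_add_latticePoint_eq_tsum_ft
    (Complex.continuous_ofReal.comp (continuous_mollify hφ.continuous hc hQ hε))
    ((hasCompactSupport_mollify_indicator hP hc hε).comp_left Complex.ofReal_zero) hs x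

/-- The normalized solid angle of `P` at `p`. -/
noncomputable def solidAngle (P : Set (Fin d → ℝ)) (p : Fin d → ℝ) : ℝ :=
  (volume (eball d)).toReal⁻¹ * (volume (tangentDirections P p ∩ eball d)).toReal

lemma tendsto_solidAngle {P : Set (Fin d → ℝ)} (hconv : Convex ℝ P) (hP : IsCompact P)
    (p : Fin d → ℝ) :
    Tendsto (fun ε : ℝ => (volume (eball d)).toReal⁻¹ *
      ∫ y in eball d, P.indicator (fun _ => (1 : ℝ)) (p - ε • y)) (𝓝[>] 0)
      (𝓝 (solidAngle P p)) := by
  have hw : Integrable ((eball d).indicator fun _ => (1 : ℝ)) :=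
    (integrableOn_const volume_eball_ne_top).integrable_indicator measurableSet_eball_pi
  have h := (tendsto_integral_mul_indicator hconv hP (continuous_const (y := (1 : ℝ))) hw
    p).const_mul (volume (eball d)).toReal⁻¹
  rw [setIntegral_indicator measurableSet_eball_pi, setIntegral_const, smul_eq_mul, mul_one,
    mul_one] at h
  refine h.congr fun ε => ?_
  rw [← integral_indicator measurableSet_eball_pi]
  congr 2
  funext y
  by_cases hy : y ∈ eball d <;> simp [hy]

lemma tendsto_mollify_indicator (hd : 1 ≤ d) {φ q : (Fin d → ℝ) → ℝ} {P : Set (Fin d → ℝ)}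
    (hφ : Continuous φ) (hc : HasCompactSupport φ)
    (hrad : ∀ x y : Fin d → ℝ, ∑ i, (x i) ^ 2 = ∑ i, (y i) ^ 2 → φ x = φ y)
    (hint : ∫ x, φ x = 1) (hconv : Convex ℝ P) (hP : IsCompact P) (hq : Continuous q)
    (p : Fin d → ℝ) :
    Tendsto (fun ε : ℝ => mollify φ (P.indicator q) ε p) (𝓝[>] 0)
      (𝓝 (solidAngle P p * q p)) := by
  have h := tendsto_integral_mul_indicator hconv hP hq (hφ.integrable_of_hasCompactSupport hc) p
  have hcone := volume_eball_mul_setIntegral_cone hd hφ hrad (smul_mem_tangentDirections P p)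
  have hne : (volume (eball d)).toReal ≠ 0 :=
    ENNReal.toReal_ne_zero.2 ⟨volume_eball_ne_zero, volume_eball_ne_top⟩
  rw [hint, mul_one, ← eq_inv_mul_iff_mul_eq₀ hne] at hcone
  rw [hcone] at h
  refine h.congr' ?_
  filter_upwards [self_mem_nhdsWithin] with ε hε
  rw [mollify_eq_integral_smul _ _ hε]

lemma tendsto_tsum_mollify_indicator (hd : 1 ≤ d) {φ q : (Fin d → ℝ) → ℝ} {P : Set (Fin d → ℝ)}
    (hφ : Continuous φ) (hc : HasCompactSupport φ)
    (hrad : ∀ x y : Fin d → ℝ, ∑ i, (x i) ^ 2 = ∑ i, (y i) ^ 2 → φ x = φ y)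
    (hint : ∫ x, φ x = 1) (hconv : Convex ℝ P) (hP : IsCompact P) (hq : Continuous q)
    (x : Fin d → ℝ) :
    Tendsto (fun ε : ℝ => ∑' k : Fin d → ℤ, mollify φ (P.indicator q) ε (x + latticePoint k))
      (𝓝[>] 0)
      (𝓝 (∑' k : Fin d → ℤ, solidAngle P (x + latticePoint k) * q (x + latticePoint k))) := by
  obtain ⟨R, hR0, hR⟩ := hc.isCompact.isBounded.subset_closedBall_lt 0 0
  have hlim (k : Fin d → ℤ) :=
    tendsto_mollify_indicator hd hφ hc hrad hint hconv hP hq (x + latticePoint k)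
  let K := (finite_add_latticePoint_mem_add_closedBall hP.isBounded x R).toFinset
  have hzero : ∀ ε ∈ Set.Ioo (0 : ℝ) 1, ∀ k ∉ K,
      mollify φ (P.indicator q) ε (x + latticePoint k) = 0 := by
    intro ε hε k hk
    by_contra hne
    refine hk ((Set.Finite.mem_toFinset _).2 ?_)
    refine Set.add_subset_add_left (Metric.closedBall_subset_closedBall ?_)
      (mem_add_closedBall_of_mollify_ne_zero ((subset_tsupport φ).trans hR) hε.1 hne)
    nlinarith [hε.2]
  have hIoo : Set.Ioo (0 : ℝ) 1 ∈ 𝓝[>] (0 : ℝ) := Ioo_mem_nhdsGT one_pos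
  rw [tsum_eq_sum (s := K) fun k hk => tendsto_nhds_unique (hlim k)
    (tendsto_const_nhds.congr' (by filter_upwards [hIoo] with ε hε using (hzero ε hε k hk).symm))]
  refine (tendsto_finsetSum K fun k _ => hlim k).congr' ?_
  filter_upwards [hIoo] with ε hε
  exact (tsum_eq_sum (hzero ε hε)).symm

end Mollification

theorem stmt8 (d : ℕ) (hd : 1 ≤ d)
    (φ : (Fin d → ℝ) → ℝ) (hφ_smooth : ContDiff ℝ (⊤ : ℕ∞) φ) (hφ_nonneg : ∀ x, 0 ≤ φ x)
    (hφ_radial : ∀ x y : Fin d → ℝ, ∑ i, (x i) ^ 2 = ∑ i, (y i) ^ 2 → φ x = φ y)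
    (hφ_supp : HasCompactSupport φ) (hφ_int : ∫ x, φ x = 1)
    (T : Finset (Fin d → ℝ)) (P : Set (Fin d → ℝ))
    (hP : P = convexHull ℝ (T : Set (Fin d → ℝ)))
    (q : (Fin d → ℝ) → ℝ) (hq : ContDiff ℝ (⊤ : ℕ∞) q) :
    (∀ ε : ℝ, 0 < ε → ∀ x : Fin d → ℝ,
      -- the left-hand series is a finite sum
      {k : Fin d → ℤ |
        (∫ y, (ε ^ d)⁻¹ * φ (ε⁻¹ • y) *
          P.indicator q ((x + fun i => (k i : ℝ)) - y)) ≠ 0}.Finite ∧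
      -- the right-hand series converges absolutely
      (Summable fun k : Fin d → ℤ =>
        ‖ft d (fun v => (φ v : ℂ)) (ε • fun i => (k i : ℝ)) *
          ft d (fun v => ((P.indicator q v : ℝ) : ℂ)) (fun i => (k i : ℝ)) *
          Complex.exp (2 * π * Complex.I * (∑ i, (k i : ℝ) * x i))‖) ∧
      -- Poisson summation formula for `φ_ε ∗ Q`
      ∑' k : Fin d → ℤ,
          ((∫ y, (ε ^ d)⁻¹ * φ (ε⁻¹ • y) *
            P.indicator q ((x + fun i => (k i : ℝ)) - y) : ℝ) : ℂ) =
        ∑' k : Fin d → ℤ,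
          ft d (fun v => (φ v : ℂ)) (ε • fun i => (k i : ℝ)) *
            ft d (fun v => ((P.indicator q v : ℝ) : ℂ)) (fun i => (k i : ℝ)) *
            Complex.exp (2 * π * Complex.I * (∑ i, (k i : ℝ) * x i))) ∧
    -- the limiting identity with the solid angle weights
    (∀ x : Fin d → ℝ, ∃ W : (Fin d → ℤ) → ℝ,
      (∀ k : Fin d → ℤ,
        Tendsto (fun ε : ℝ =>
            (volume (eball d)).toReal⁻¹ *
              ∫ y in eball d,
                P.indicator (fun _ => (1 : ℝ)) ((x + fun i => (k i : ℝ)) - ε • y))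
          (𝓝[>] 0) (𝓝 (W k))) ∧
      Tendsto (fun ε : ℝ =>
          ∑' k : Fin d → ℤ,
            ft d (fun v => (φ v : ℂ)) (ε • fun i => (k i : ℝ)) *
              ft d (fun v => ((P.indicator q v : ℝ) : ℂ)) (fun i => (k i : ℝ)) *
              Complex.exp (2 * π * Complex.I * (∑ i, (k i : ℝ) * x i)))
        (𝓝[>] 0)
        (𝓝 ((∑' k : Fin d → ℤ, (W k * q (x + fun i => (k i : ℝ)) : ℝ) : ℝ) : ℂ))) := by
  have hPc : IsCompact P := hP ▸ T.finite_toSet.isCompact_convexHull ℝ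
  have hconv : Convex ℝ P := hP ▸ convex_convexHull ℝ _
  have hφc : ContDiff ℝ (⊤ : ℕ∞) fun v => (φ v : ℂ) := Complex.ofRealCLM.contDiff.comp hφ_smooth
  refine ⟨fun ε hε x => ⟨?_, ?_, ?_⟩, fun x => ⟨fun k => solidAngle P (x + latticePoint k),
    fun k => tendsto_solidAngle hconv hPc _, ?_⟩⟩
  · obtain ⟨R, hR⟩ := hφ_supp.isCompact.isBounded.subset_closedBall 0
    exact (finite_add_latticePoint_mem_add_closedBall hPc.isBounded x (ε * R)).subset fun k hk =>
      mem_add_closedBall_of_mollify_ne_zero ((subset_tsupport φ).trans hR) hε hk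
  · refine (summable_norm_ft_mul_ft (Q := fun v => ((P.indicator q v : ℝ) : ℂ)) hφc
      (hφ_supp.comp_left Complex.ofReal_zero) hε).congr fun k => ?_
    rw [norm_mul _ (Complex.exp _), show (2 * π * Complex.I * ((∑ i, (k i : ℝ) * x i : ℝ) : ℂ)) =
      ((2 * π * (∑ i, (k i : ℝ) * x i) : ℝ) : ℂ) * Complex.I by push_cast; ring,
      Complex.norm_exp_ofReal_mul_I, mul_one]
    rfl
  · exact tsum_mollify_eq_tsum_ft hφ_smooth hφ_supp hPc hq.continuous hε x
  · have h := tendsto_tsum_mollify_indicator hd hφ_smooth.continuous hφ_supp hφ_radial hφ_int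
      hconv hPc hq.continuous x
    refine ((Complex.continuous_ofReal.tendsto _).comp h).congr' ?_
    filter_upwards [self_mem_nhdsWithin] with ε hε
    rw [Function.comp_apply, Complex.ofReal_tsum]
    exact tsum_mollify_eq_tsum_ft hφ_smooth hφ_supp hPc hq.continuous hε x
end

section
/- The family {Q(θ)}_{θ∈Θ_d} is a partition of ℝ^d: the sets Q(θ) are pairwise disjoint for distinct θ ∈ Θ_d, and their union is all of ℝ^d. -/
/-- The `k`-th vector of the basis `B_v ∈ F^{(d)}` indexed by `v` (only the components
`v_2,…,v_d` matter; `v m = true` encodes `v_m = 2`).  Explicitly, `b_k = e_k - e_m` where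
`m` is the least index `m > k` with `v_m = 2`, and `b_k = e_k` if there is no such `m`.
This closed form agrees with the recursive definition of the families `F^{(d)}`. -/
def baseVec (d : ℕ) (v : Fin d → Bool) (k : Fin d) : Fin d → ℝ := fun i =>
  (if i = k then (1 : ℝ) else 0) -
    (if k < i ∧ v i = true ∧ (∀ m : Fin d, k < m → v m = true → i ≤ m) then (1 : ℝ) else 0)

/-- The set of all vectors occurring in the bases of `F^{(d)}`. -/
def allBaseVecs (d : ℕ) : Set (Fin d → ℝ) := {b | ∃ v k, b = baseVec d v k}

/-- `Θ_d`: all subspaces of `ℝ^d` spanned by sets of vectors from the bases of `F^{(d)}`. -/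
def Theta (d : ℕ) : Set (Submodule ℝ (Fin d → ℝ)) :=
  {θ | ∃ s : Set (Fin d → ℝ), s ⊆ allBaseVecs d ∧ θ = Submodule.span ℝ s}

/-- The cone `Q(θ)`: points orthogonal exactly to the basis vectors lying in `θ`. -/
def Qcone (d : ℕ) (θ : Submodule ℝ (Fin d → ℝ)) : Set (Fin d → ℝ) :=
  {ξ | ∀ b ∈ allBaseVecs d, ((∑ i, ξ i * b i) = 0 ↔ b ∈ θ)}

/-- A subspace in `Θ_d` is spanned by the basis vectors it contains. -/
lemma Theta.span_inter_allBaseVecs {d : ℕ} {θ : Submodule ℝ (Fin d → ℝ)} (hθ : θ ∈ Theta d) :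
    Submodule.span ℝ {b | b ∈ allBaseVecs d ∧ b ∈ θ} = θ := by
  obtain ⟨s, hs, rfl⟩ := hθ
  exact le_antisymm (Submodule.span_le.2 fun _ hb => hb.2)
    (Submodule.span_mono fun _ hb => ⟨hs hb, Submodule.subset_span hb⟩)

/-- A subspace in `Θ_d` is determined by any point of its cone. -/
lemma Theta.eq_span_of_mem_Qcone {d : ℕ} {θ : Submodule ℝ (Fin d → ℝ)} (hθ : θ ∈ Theta d)
    {ξ : Fin d → ℝ} (hξ : ξ ∈ Qcone d θ) :
    θ = Submodule.span ℝ {b | b ∈ allBaseVecs d ∧ ∑ i, ξ i * b i = 0} := by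
  rw [← Theta.span_inter_allBaseVecs hθ]
  congr 1
  ext b
  exact and_congr_right fun hb => (hξ b hb).symm

/-- Every point lies in the cone of the span of the basis vectors orthogonal to it. -/
lemma mem_Qcone_span_orthogonal {d : ℕ} (ξ : Fin d → ℝ) :
    ξ ∈ Qcone d (Submodule.span ℝ {b | b ∈ allBaseVecs d ∧ ∑ i, ξ i * b i = 0}) := by
  intro b hb
  refine ⟨fun h => Submodule.subset_span ⟨hb, h⟩, fun h => ?_⟩
  have hle : Submodule.span ℝ {b | b ∈ allBaseVecs d ∧ ∑ i, ξ i * b i = 0} ≤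
      LinearMap.ker (dotProductBilin ℝ ℝ ξ) :=
    Submodule.span_le.2 fun _ hc => hc.2
  exact hle h

theorem stmt9 (d : ℕ) (hd : 1 ≤ d) :
    ((Theta d).PairwiseDisjoint (Qcone d)) ∧
    (⋃ θ ∈ Theta d, Qcone d θ) = Set.univ := by
  refine ⟨fun θ hθ η hη hne => Set.disjoint_left.2 fun ξ hξθ hξη => hne ?_, ?_⟩
  · exact (Theta.eq_span_of_mem_Qcone hθ hξθ).trans (Theta.eq_span_of_mem_Qcone hη hξη).symm
  · refine Set.eq_univ_of_forall fun ξ => Set.mem_iUnion₂.2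
      ⟨_, ⟨_, fun _ hb => hb.1, rfl⟩, mem_Qcone_span_orthogonal ξ⟩
end

section
/- Let θ ∈ Θ_d. There exists a constant c(θ) such that for every bounded function F on the torus 𝕋^d = ℝ^d/ℤ^d, the trigonometric series Σ_{m ∈ Q(θ)∩ℤ^d} F̂(m) e^{2πim·x} is the Fourier series of a bounded function G on 𝕋^d (i.e. Ĝ(m) = F̂(m) for m ∈ Q(θ)∩ℤ^d and Ĝ(m) = 0 otherwise), with sup_x |G(x)| ≤ c(θ) sup_x |F(x)|. -/
open scoped Real
open MeasureTheory

/-- Fourier coefficient of a `ℤ^d`-periodic function on the torus: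
`F̂(m) = ∫_{[0,1)^d} F(x) e^{-2πi m·x} dx`. -/
noncomputable def tFC (d : ℕ) (F : (Fin d → ℝ) → ℂ) (m : Fin d → ℤ) : ℂ :=
  ∫ x in Set.univ.pi (fun _ : Fin d => Set.Ico (0 : ℝ) 1),
    F x * Complex.exp (-2 * π * Complex.I * (∑ i, (m i : ℝ) * x i))

/-- `S` is a set of frequencies such that restricting Fourier series to `S` is a bounded operation
on bounded measurable `ℤ^d`-periodic functions. -/
def IsBoundedMultiplierSet (d : ℕ) (S : Set (Fin d → ℤ)) : Prop :=
  ∃ c : ℝ, ∀ F : (Fin d → ℝ) → ℂ, Measurable F →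
    (∀ (x : Fin d → ℝ) (m : Fin d → ℤ), F (x + fun i => (m i : ℝ)) = F x) →
    (∃ C : ℝ, ∀ x, ‖F x‖ ≤ C) →
    ∃ G : (Fin d → ℝ) → ℂ, Measurable G ∧
      (∀ (x : Fin d → ℝ) (m : Fin d → ℤ), G (x + fun i => (m i : ℝ)) = G x) ∧
      (∀ m : Fin d → ℤ, (m ∈ S → tFC d G m = tFC d F m) ∧ (m ∉ S → tFC d G m = 0)) ∧
      (∀ C : ℝ, (∀ x, ‖F x‖ ≤ C) → ∀ x, ‖G x‖ ≤ c * C)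

/-- The half-open unit cube. -/
abbrev unitCube (d : ℕ) : Set (Fin d → ℝ) := Set.univ.pi (fun _ : Fin d => Set.Ico (0 : ℝ) 1)

/-- The character `x ↦ e^{-2πi m·x}`. -/
noncomputable abbrev conjChar (d : ℕ) (m : Fin d → ℤ) (x : Fin d → ℝ) : ℂ :=
  Complex.exp (-2 * π * Complex.I * (∑ i, (m i : ℝ) * x i))

theorem volume_unitCube (d : ℕ) : volume (unitCube d) = 1 := by
  simp [unitCube, volume_pi_pi]

instance isProbabilityMeasure_restrict_unitCube (d : ℕ) :
    IsProbabilityMeasure (volume.restrict (unitCube d)) :=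
  ⟨by rw [Measure.restrict_apply_univ, volume_unitCube]⟩

theorem norm_conjChar (d : ℕ) (m : Fin d → ℤ) (x : Fin d → ℝ) : ‖conjChar d m x‖ = 1 := by
  have h : (-2 * π * Complex.I * (∑ i, (m i : ℝ) * x i) : ℂ)
      = ((-2 * π * ∑ i, (m i : ℝ) * x i : ℝ) : ℂ) * Complex.I := by
    push_cast; ring
  rw [conjChar, h, Complex.norm_exp_ofReal_mul_I]

theorem measurable_conjChar (d : ℕ) (m : Fin d → ℤ) : Measurable (conjChar d m) := by
  unfold conjChar; fun_prop

theorem conjChar_add (d : ℕ) (m : Fin d → ℤ) (x y : Fin d → ℝ) :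
    conjChar d m (x + y) = conjChar d m x * conjChar d m y := by
  simp only [conjChar, ← Complex.exp_add, Pi.add_apply, mul_add, Finset.sum_add_distrib,
    Complex.ofReal_add]

theorem conjChar_intCast (d : ℕ) (m n : Fin d → ℤ) :
    conjChar d m (fun i => (n i : ℝ)) = 1 := by
  rw [conjChar, Complex.exp_eq_one_iff]
  refine ⟨-∑ i, m i * n i, ?_⟩
  push_cast; ring

theorem integrable_mul_conjChar {d : ℕ} {F : (Fin d → ℝ) → ℂ} (hF : Measurable F) {C : ℝ}
    (hC : ∀ x, ‖F x‖ ≤ C) (m : Fin d → ℤ) :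
    Integrable (fun x => F x * conjChar d m x) (volume.restrict (unitCube d)) := by
  refine Integrable.of_bound (hF.mul (measurable_conjChar d m)).aestronglyMeasurable C ?_
  exact Filter.Eventually.of_forall fun x => by rw [norm_mul, norm_conjChar, mul_one]; exact hC x

open scoped Pointwise in
/-- The integral of a `ℤ^d`-periodic function over the unit cube is translation invariant. -/
theorem setIntegral_unitCube_add_right {d : ℕ} {f : (Fin d → ℝ) → ℂ}
    (hf : ∀ (x : Fin d → ℝ) (m : Fin d → ℤ), f (x + fun i => (m i : ℝ)) = f x)
    (a : Fin d → ℝ) : ∫ x in unitCube d, f (x + a) = ∫ x in unitCube d, f x := by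
  set b := Pi.basisFun ℝ (Fin d)
  have hs := ZSpan.isAddFundamentalDomain' b volume
  have hcube : ZSpan.fundamentalDomain b = unitCube d := by
    simpa [b] using ZSpan.fundamentalDomain_pi_basisFun (ι := Fin d)
  have hinv : ∀ (g : (Submodule.span ℤ (Set.range b)).toAddSubgroup) (x : Fin d → ℝ),
      f (g +ᵥ x) = f x := by
    rintro ⟨g, hg⟩ x
    have hg' : ∀ i, ∃ n : ℤ, (n : ℝ) = g i := by
      have := (b.mem_span_iff_repr_mem ℤ g).1 hg
      simpa [b] using this
    choose n hn using hg'
    rw [← hf x n]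
    congr 1
    ext i
    simp [AddSubgroup.vadd_def, hn, add_comm]
  have ht := hs.vadd_of_comm a
  have : Countable (Submodule.span ℤ (Set.range b)).toAddSubgroup :=
    inferInstanceAs (Countable (Submodule.span ℤ (Set.range b)))
  have h := hs.setIntegral_eq ht hinv
  rw [hcube] at h
  have hpre : (fun x => x + a) ⁻¹' (a +ᵥ unitCube d) = unitCube d := by
    ext x
    rw [Set.mem_preimage, add_comm, ← vadd_eq_add, Set.vadd_mem_vadd_set_iff]
  rw [h, ← (measurePreserving_add_right volume a).setIntegral_preimage_emb
    (measurableEmbedding_addRight a) f (a +ᵥ unitCube d), hpre]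

theorem IsBoundedMultiplierSet.compl {d : ℕ} {S : Set (Fin d → ℤ)}
    (hS : IsBoundedMultiplierSet d S) : IsBoundedMultiplierSet d Sᶜ := by
  obtain ⟨c, hc⟩ := hS
  refine ⟨1 + c, fun F hF hper ⟨C₀, hC₀⟩ => ?_⟩
  obtain ⟨G, hG, hGper, hcoef, hbd⟩ := hc F hF hper ⟨C₀, hC₀⟩
  have hsub : ∀ m, tFC d (fun x => F x - G x) m = tFC d F m - tFC d G m := fun m => by
    simp only [tFC, sub_mul]
    exact integral_sub (integrable_mul_conjChar hF hC₀ m)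
      (integrable_mul_conjChar hG (hbd C₀ hC₀) m)
  refine ⟨fun x => F x - G x, hF.sub hG, fun x m => by simp only [hper, hGper], fun m => ⟨?_, ?_⟩, ?_⟩
  · intro hm
    rw [hsub, (hcoef m).2 hm, sub_zero]
  · intro hm
    rw [hsub, (hcoef m).1 (not_not.1 hm), sub_self]
  · intro C hC x
    calc ‖F x - G x‖ ≤ ‖F x‖ + ‖G x‖ := norm_sub_le _ _
      _ ≤ C + c * C := add_le_add (hC x) (hbd C hC x)
      _ = (1 + c) * C := by ring

theorem IsBoundedMultiplierSet.inter {d : ℕ} {S T : Set (Fin d → ℤ)}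
    (hS : IsBoundedMultiplierSet d S) (hT : IsBoundedMultiplierSet d T) :
    IsBoundedMultiplierSet d (S ∩ T) := by
  obtain ⟨c, hc⟩ := hS
  obtain ⟨c', hc'⟩ := hT
  refine ⟨c' * c, fun F hF hper ⟨C₀, hC₀⟩ => ?_⟩
  obtain ⟨G, hG, hGper, hcoef, hbd⟩ := hc F hF hper ⟨C₀, hC₀⟩
  obtain ⟨H, hH, hHper, hcoef', hbd'⟩ := hc' G hG hGper ⟨_, hbd C₀ hC₀⟩
  refine ⟨H, hH, hHper, fun m => ⟨fun hm => ?_, fun hm => ?_⟩, fun C hC x => ?_⟩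
  · rw [(hcoef' m).1 hm.2, (hcoef m).1 hm.1]
  · by_cases hmT : m ∈ T
    · rw [(hcoef' m).1 hmT, (hcoef m).2 fun hmS => hm ⟨hmS, hmT⟩]
    · exact (hcoef' m).2 hmT
  · rw [mul_assoc]
    exact hbd' _ (hbd C hC) x

theorem isBoundedMultiplierSet_univ (d : ℕ) : IsBoundedMultiplierSet d Set.univ :=
  ⟨1, fun F hF hper _ => ⟨F, hF, hper, fun m => ⟨fun _ => rfl, fun h => (h trivial).elim⟩,
    fun C hC x => by simpa using hC x⟩⟩

theorem IsBoundedMultiplierSet.biInter {d : ℕ} {ι : Type*} {A : Set ι} (hA : A.Finite)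
    {S : ι → Set (Fin d → ℤ)} (hS : ∀ a ∈ A, IsBoundedMultiplierSet d (S a)) :
    IsBoundedMultiplierSet d (⋂ a ∈ A, S a) := by
  induction A, hA using Set.Finite.induction_on with
  | empty => simpa using isBoundedMultiplierSet_univ d
  | insert _ _ ih =>
    rw [Set.biInter_insert]
    exact (hS _ (Set.mem_insert _ _)).inter (ih fun a ha => hS a (Set.mem_insert_of_mem _ ha))

theorem integral_conjChar_neg_smul {d : ℕ} (m b : Fin d → ℤ) :
    ∫ t in Set.Ioc (0 : ℝ) 1, conjChar d m (-(t • fun i => (b i : ℝ)))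
      = if ∑ i, m i * b i = 0 then 1 else 0 := by
  have hexp : ∀ t : ℝ, conjChar d m (-(t • fun i => (b i : ℝ)))
      = Complex.exp ((2 * π * Complex.I * (∑ i, m i * b i : ℤ)) * t) := fun t => by
    rw [conjChar]
    congr 1
    push_cast
    simp only [Pi.neg_apply, Pi.smul_apply, smul_eq_mul, Complex.ofReal_neg, Complex.ofReal_mul,
      Complex.ofReal_intCast, Finset.mul_sum, Finset.sum_mul]
    exact Finset.sum_congr rfl fun i _ => by ring
  simp only [hexp]
  split_ifs with h
  · simp [h]
  · have hne : (2 * π * Complex.I * (∑ i, m i * b i : ℤ) : ℂ) ≠ 0 :=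
      mul_ne_zero Complex.two_pi_I_ne_zero (Int.cast_ne_zero.2 h)
    rw [← intervalIntegral.integral_of_le zero_le_one, integral_exp_mul_complex hne]
    have h1 : Complex.exp (2 * π * Complex.I * (∑ i, m i * b i : ℤ)) = 1 :=
      Complex.exp_eq_one_iff.2 ⟨∑ i, m i * b i, by ring⟩
    simp only [Complex.ofReal_one, mul_one, h1, Complex.ofReal_zero, mul_zero, Complex.exp_zero,
      sub_self, zero_div]

/-- Averaging along the closed one-parameter subgroup generated by an integer vector `b` projects
onto the frequencies orthogonal to `b`. -/
theorem isBoundedMultiplierSet_orthogonal {d : ℕ} (b : Fin d → ℤ) :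
    IsBoundedMultiplierSet d {m | ∑ i, m i * b i = 0} := by
  refine ⟨1, fun F hF hper ⟨C₀, hC₀⟩ => ?_⟩
  set β : Fin d → ℝ := fun i => (b i : ℝ) with hβ
  have hmeas : Measurable fun p : (Fin d → ℝ) × ℝ => F (p.1 + p.2 • β) :=
    hF.comp (by fun_prop)
  refine ⟨fun x => ∫ t in Set.Ioc (0 : ℝ) 1, F (x + t • β),
    (hmeas.stronglyMeasurable.integral_prod_right).measurable, fun x m => ?_, fun m => ?_,
    fun C hC x => ?_⟩
  · simp only [add_right_comm x _ (_ • β), hper]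
  · have hshift : ∀ t : ℝ, ∫ x in unitCube d, F (x + t • β) * conjChar d m x
        = conjChar d m (-(t • β)) * tFC d F m := fun t => by
      have hinv := setIntegral_unitCube_add_right (f := fun x => F x * conjChar d m x)
        (fun x n => by simp only [hper, conjChar_add, conjChar_intCast, mul_one]) (t • β)
      rw [tFC, ← hinv, ← integral_const_mul]
      refine integral_congr_ae (Filter.Eventually.of_forall fun x => ?_)
      have hx : conjChar d m x = conjChar d m (-(t • β)) * conjChar d m (x + t • β) := by
        rw [← conjChar_add]; congr 1; abel
      simp only
      rw [hx]; ring
    have hcoef : tFC d (fun x => ∫ t in Set.Ioc (0 : ℝ) 1, F (x + t • β)) m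
        = (if ∑ i, m i * b i = 0 then 1 else 0) * tFC d F m := by
      calc tFC d (fun x => ∫ t in Set.Ioc (0 : ℝ) 1, F (x + t • β)) m
          = ∫ x in unitCube d, ∫ t in Set.Ioc (0 : ℝ) 1, F (x + t • β) * conjChar d m x := by
            simp only [tFC, integral_mul_const]
        _ = ∫ t in Set.Ioc (0 : ℝ) 1, ∫ x in unitCube d, F (x + t • β) * conjChar d m x := by
            refine integral_integral_swap (Integrable.of_bound (hmeas.mul
              ((measurable_conjChar d m).comp measurable_fst)).aestronglyMeasurable C₀
              (Filter.Eventually.of_forall fun p => ?_))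
            change ‖F (p.1 + p.2 • β) * conjChar d m p.1‖ ≤ C₀
            rw [norm_mul, norm_conjChar, mul_one]
            exact hC₀ _
        _ = _ := by
            simp only [hshift, integral_mul_const]
            rw [integral_conjChar_neg_smul]
    refine ⟨fun hm => ?_, fun hm => ?_⟩
    · rw [hcoef, if_pos (Set.mem_ofPred.1 hm), one_mul]
    · rw [hcoef, if_neg (Set.mem_ofPred.not.1 hm), zero_mul]
  · refine (norm_setIntegral_le_of_norm_le_const (C := C) (by simp) fun t _ => hC _).trans ?_
    simp

theorem finite_allBaseVecs (d : ℕ) : (allBaseVecs d).Finite := by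
  refine (Set.finite_range fun p : (Fin d → Bool) × Fin d => baseVec d p.1 p.2).subset ?_
  rintro b ⟨v, k, rfl⟩
  exact ⟨(v, k), rfl⟩

theorem exists_intCast_eq_of_mem_allBaseVecs {d : ℕ} {b : Fin d → ℝ} (hb : b ∈ allBaseVecs d) :
    ∃ n : Fin d → ℤ, b = fun i => (n i : ℝ) := by
  obtain ⟨v, k, rfl⟩ := hb
  refine ⟨fun i => (if i = k then 1 else 0) -
    (if k < i ∧ v i = true ∧ (∀ m : Fin d, k < m → v m = true → i ≤ m) then 1 else 0), ?_⟩
  ext i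
  simp only [baseVec]
  push_cast
  rfl

theorem stmt10 (d : ℕ) (hd : 1 ≤ d) (θ : Submodule ℝ (Fin d → ℝ)) (hθ : θ ∈ Theta d) :
    ∃ c : ℝ, ∀ F : (Fin d → ℝ) → ℂ, Measurable F →
      (∀ (x : Fin d → ℝ) (m : Fin d → ℤ), F (x + fun i => (m i : ℝ)) = F x) →
      (∃ C : ℝ, ∀ x, ‖F x‖ ≤ C) →
      ∃ G : (Fin d → ℝ) → ℂ, Measurable G ∧
        (∀ (x : Fin d → ℝ) (m : Fin d → ℤ), G (x + fun i => (m i : ℝ)) = G x) ∧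
        (∀ m : Fin d → ℤ,
          ((fun i => (m i : ℝ)) ∈ Qcone d θ → tFC d G m = tFC d F m) ∧
          ((fun i => (m i : ℝ)) ∉ Qcone d θ → tFC d G m = 0)) ∧
        (∀ C : ℝ, (∀ x, ‖F x‖ ≤ C) → ∀ x, ‖G x‖ ≤ c * C) := by
  have hQ : IsBoundedMultiplierSet d (⋂ b ∈ allBaseVecs d,
      {m : Fin d → ℤ | (∑ i, (m i : ℝ) * b i) = 0 ↔ b ∈ θ}) := by
    refine IsBoundedMultiplierSet.biInter (finite_allBaseVecs d) fun b hb => ?_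
    obtain ⟨n, rfl⟩ := exists_intCast_eq_of_mem_allBaseVecs hb
    have hcast : ∀ m : Fin d → ℤ, (∑ i, (m i : ℝ) * n i) = 0 ↔ ∑ i, m i * n i = 0 :=
      fun m => by exact_mod_cast Iff.rfl
    simp only [hcast]
    by_cases h : (fun i => (n i : ℝ)) ∈ θ
    · simpa only [h, iff_true] using isBoundedMultiplierSet_orthogonal n
    · simpa only [h, iff_false, Set.compl_ofPred] using (isBoundedMultiplierSet_orthogonal n).compl
  have hset : (⋂ b ∈ allBaseVecs d, {m : Fin d → ℤ | (∑ i, (m i : ℝ) * b i) = 0 ↔ b ∈ θ})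
      = {m | (fun i => (m i : ℝ)) ∈ Qcone d θ} := by
    ext m
    simp [Qcone]
  rw [hset] at hQ
  exact hQ
end

section
/- Let 2 ≤ h ≤ d, θ ∈ Θ_h and B ∈ F^(h), and let U_h : ℝ^h → ℝ^{h−1} be the map removing the last coordinate. Define P_{h,B}θ = U_h θ if e_h ∈ θ, P_{h,B}θ = U_h( θ ∩ {x : x·e_h = 0} ) if e_h ∉ θ and B ∈ F_1^(h), and P_{h,B}θ = U_h( θ ∩ {x : x·1_h = 0} ) if e_h ∉ θ and B ∈ F_2^(h). Then in all cases P_{h,B}θ = U_h( θ ∩ {x : x·e_h = 0} ) when B ∈ F_1^(h) and P_{h,B}θ = U_h( θ ∩ {x : x·1_h = 0} ) when B ∈ F_2^(h), and P_{h,B}θ ∈ Θ_{h−1}. -/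
/-- `U_h : ℝ^h → ℝ^{h-1}`, the linear map removing the last coordinate (`h = m+1`). -/
noncomputable def Umap (m : ℕ) : (Fin (m + 1) → ℝ) →ₗ[ℝ] (Fin m → ℝ) :=
  LinearMap.funLeft ℝ ℝ Fin.castSucc

/-- The hyperplane `{x : x·e_h = 0}` in `ℝ^{m+1}`. -/
noncomputable def kerLast (m : ℕ) : Submodule ℝ (Fin (m + 1) → ℝ) :=
  LinearMap.ker (LinearMap.proj (Fin.last m) : (Fin (m + 1) → ℝ) →ₗ[ℝ] ℝ)

/-- The hyperplane `{x : x·1 = 0}` in `ℝ^{m+1}`. -/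
noncomputable def kerOnes (m : ℕ) : Submodule ℝ (Fin (m + 1) → ℝ) :=
  LinearMap.ker (∑ i : Fin (m + 1), (LinearMap.proj i : (Fin (m + 1) → ℝ) →ₗ[ℝ] ℝ))

/-- The standard basis vectors of `ℝ^d` together with the origin, which is indexed by `none`. -/
def vertexVec (d : ℕ) : Option (Fin d) → Fin d → ℝ
  | none => 0
  | some k => Pi.single k 1

/-- The differences of any two of the points `vertexVec d p`. -/
def edgeVecs (d : ℕ) : Set (Fin d → ℝ) :=
  {b | ∃ p q, b = vertexVec d p - vertexVec d q}

theorem allBaseVecs_subset_edgeVecs (d : ℕ) : allBaseVecs d ⊆ edgeVecs d := by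
  rintro _ ⟨v, k, rfl⟩
  by_cases hex : ∃ l, k < l ∧ v l = true
  · obtain ⟨l, ⟨hkl, hvl⟩, hmin⟩ :=
      WellFounded.has_min (wellFounded_lt (α := Fin d)) {l | k < l ∧ v l = true} hex
    refine ⟨some k, some l, ?_⟩
    have hle : ∀ n, k < n → v n = true → l ≤ n := fun n h₁ h₂ => not_lt.mp (hmin n ⟨h₁, h₂⟩)
    funext i
    have hi : (k < i ∧ v i = true ∧ ∀ n : Fin d, k < n → v n = true → i ≤ n) ↔ i = l := by
      constructor
      · rintro ⟨h₁, h₂, h₃⟩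
        exact le_antisymm (h₃ l hkl hvl) (hle i h₁ h₂)
      · rintro rfl
        exact ⟨hkl, hvl, hle⟩
    simp only [baseVec, vertexVec, Pi.sub_apply, Pi.single_apply, hi]
  · refine ⟨some k, none, ?_⟩
    funext i
    have hi : ¬ (k < i ∧ v i = true ∧ ∀ n : Fin d, k < n → v n = true → i ≤ n) :=
      fun h => hex ⟨i, h.1, h.2.1⟩
    simp [baseVec, vertexVec, Pi.single_apply, hi]

theorem vertexVec_some_mem_allBaseVecs {d : ℕ} (k : Fin d) :
    vertexVec d (some k) ∈ allBaseVecs d :=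
  ⟨fun _ => false, k, by funext i; simp [baseVec, vertexVec, Pi.single_apply]⟩

theorem vertexVec_sub_mem_allBaseVecs {d : ℕ} {k l : Fin d} (hkl : k < l) :
    vertexVec d (some k) - vertexVec d (some l) ∈ allBaseVecs d := by
  refine ⟨fun i => decide (i = l), k, ?_⟩
  funext i
  have hi : (k < i ∧ decide (i = l) = true ∧
      ∀ n : Fin d, k < n → decide (n = l) = true → i ≤ n) ↔ i = l := by
    simp only [decide_eq_true_eq]
    constructor
    · exact fun h => h.2.1
    · rintro rfl
      exact ⟨hkl, rfl, fun n _ hn => hn.ge⟩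
  simp only [baseVec, vertexVec, Pi.sub_apply, Pi.single_apply, hi]

theorem edgeVecs_cases {d : ℕ} {b : Fin d → ℝ} (hb : b ∈ edgeVecs d) :
    b = 0 ∨ b ∈ allBaseVecs d ∨ -b ∈ allBaseVecs d := by
  obtain ⟨p, q, rfl⟩ := hb
  rcases p with _ | k <;> rcases q with _ | l
  · simp
  · right; right
    simpa [vertexVec] using vertexVec_some_mem_allBaseVecs l
  · right; left
    simpa [vertexVec] using vertexVec_some_mem_allBaseVecs k
  · rcases lt_trichotomy k l with h | rfl | h
    · exact Or.inr (Or.inl (vertexVec_sub_mem_allBaseVecs h))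
    · simp
    · right; right
      rw [neg_sub]
      exact vertexVec_sub_mem_allBaseVecs h

theorem span_mem_Theta {d : ℕ} {t : Set (Fin d → ℝ)} (ht : t ⊆ edgeVecs d) :
    Submodule.span ℝ t ∈ Theta d := by
  refine ⟨allBaseVecs d ∩ Submodule.span ℝ t, Set.inter_subset_left, le_antisymm ?_ ?_⟩
  · rw [Submodule.span_le]
    intro b hb
    have hbt := Submodule.subset_span (R := ℝ) hb
    rcases edgeVecs_cases (ht hb) with rfl | h | h
    · exact Submodule.zero_mem _
    · exact Submodule.subset_span ⟨h, hbt⟩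
    · exact (Submodule.neg_mem_iff _).mp
        (Submodule.subset_span ⟨h, (Submodule.neg_mem_iff _).mpr hbt⟩)
  · exact Submodule.span_le.mpr Set.inter_subset_right

theorem Umap_vertexVec (m : ℕ) (p : Option (Fin (m + 1))) :
    ∃ q, Umap m (vertexVec (m + 1) p) = vertexVec m q := by
  rcases p with _ | k
  · exact ⟨none, by simp [vertexVec]⟩
  · induction k using Fin.lastCases with
    | last =>
      refine ⟨none, ?_⟩
      funext i
      simp [Umap, vertexVec, LinearMap.funLeft_apply, Fin.ext_iff, i.isLt.ne]
    | cast j =>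
      refine ⟨some j, ?_⟩
      funext i
      simp [Umap, vertexVec, LinearMap.funLeft_apply, Pi.single_apply]

theorem Umap_mem_edgeVecs {m : ℕ} {b : Fin (m + 1) → ℝ} (hb : b ∈ edgeVecs (m + 1)) :
    Umap m b ∈ edgeVecs m := by
  obtain ⟨p, q, rfl⟩ := hb
  obtain ⟨p', hp⟩ := Umap_vertexVec m p
  obtain ⟨q', hq⟩ := Umap_vertexVec m q
  exact ⟨p', q', by rw [map_sub, hp, hq]⟩

/-- A functional that is constant on all the points `vertexVec d p` but one
eliminates an edge vector from another one within the edge vectors. -/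
theorem sub_smul_mem_edgeVecs {d : ℕ} (φ : (Fin d → ℝ) →ₗ[ℝ] ℝ) (star : Option (Fin d)) (a : ℝ)
    (hφ : ∀ p, p ≠ star → φ (vertexVec d p) = a) {u w : Fin d → ℝ}
    (hu : u ∈ edgeVecs d) (hw : w ∈ edgeVecs d) (hφu : φ u ≠ 0) :
    w - (φ w / φ u) • u ∈ edgeVecs d := by
  by_cases hφw : φ w = 0
  · simpa [hφw] using hw
  have endpoint : ∀ b ∈ edgeVecs d, φ b ≠ 0 →
      ∃ q, φ (vertexVec d q) = a ∧
        (b = vertexVec d star - vertexVec d q ∨ b = vertexVec d q - vertexVec d star) := by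
    rintro _ ⟨p, q, rfl⟩ hb
    rw [map_sub] at hb
    by_cases hp : p = star
    · by_cases hq : q = star
      · simp [hp, hq] at hb
      · exact ⟨q, hφ q hq, Or.inl (by rw [hp])⟩
    · by_cases hq : q = star
      · exact ⟨p, hφ p hp, Or.inr (by rw [hq])⟩
      · simp [hφ p hp, hφ q hq] at hb
  obtain ⟨q, hq, hu'⟩ := endpoint u hu hφu
  obtain ⟨r, hr, hw'⟩ := endpoint w hw hφw
  rcases hu' with rfl | rfl <;> rcases hw' with rfl | rfl <;>
    simp only [map_sub, hq, hr] at hφu ⊢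
  · exact ⟨q, r, by rw [div_self hφu, one_smul]; abel⟩
  · refine ⟨r, q, ?_⟩
    rw [← neg_sub (φ (vertexVec d star)) a, neg_div, div_self hφu, neg_one_smul]; abel
  · refine ⟨q, r, ?_⟩
    rw [← neg_sub a (φ (vertexVec d star)), neg_div, div_self hφu, neg_one_smul]; abel
  · exact ⟨r, q, by rw [div_self hφu, one_smul]; abel⟩

theorem map_Umap_inf_ker_mem_Theta {m : ℕ} (φ : (Fin (m + 1) → ℝ) →ₗ[ℝ] ℝ)
    (star : Option (Fin (m + 1))) (a : ℝ)
    (hφ : ∀ p, p ≠ star → φ (vertexVec (m + 1) p) = a)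
    {θ : Submodule ℝ (Fin (m + 1) → ℝ)} (hθ : θ ∈ Theta (m + 1)) :
    Submodule.map (Umap m) (θ ⊓ LinearMap.ker φ) ∈ Theta m := by
  obtain ⟨s, hs, rfl⟩ := hθ
  have hsE := hs.trans (allBaseVecs_subset_edgeVecs (m + 1))
  suffices ∃ t ⊆ edgeVecs (m + 1),
      Submodule.span ℝ s ⊓ LinearMap.ker φ = Submodule.span ℝ t by
    obtain ⟨t, ht, h⟩ := this
    rw [h, Submodule.map_span]
    apply span_mem_Theta
    rintro _ ⟨b, hb, rfl⟩
    exact Umap_mem_edgeVecs (ht hb)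
  by_cases hex : ∃ u ∈ s, φ u ≠ 0
  · obtain ⟨u, hu, hφu⟩ := hex
    set r : (Fin (m + 1) → ℝ) →ₗ[ℝ] (Fin (m + 1) → ℝ) :=
      LinearMap.id - ((φ u)⁻¹ • φ).smulRight u with hr
    have r_apply : ∀ w, r w = w - (φ w / φ u) • u := by
      intro w
      simp [hr, div_eq_inv_mul]
    refine ⟨r '' s, ?_, ?_⟩
    · rintro _ ⟨w, hw, rfl⟩
      rw [r_apply]
      exact sub_smul_mem_edgeVecs φ star a hφ (hsE hu) (hsE hw) hφu
    · rw [← Submodule.map_span]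
      apply le_antisymm
      · rintro x ⟨hx, hx0⟩
        have hx0 : φ x = 0 := hx0
        exact ⟨x, hx, by simp [r_apply, hx0]⟩
      · rintro _ ⟨x, hx, rfl⟩
        rw [r_apply]
        refine ⟨Submodule.sub_mem _ hx (Submodule.smul_mem _ _ (Submodule.subset_span hu)), ?_⟩
        simp [hφu]
  · push Not at hex
    exact ⟨s, hsE, inf_eq_left.mpr (Submodule.span_le.mpr hex)⟩

theorem map_eq_map_inf_ker {K V W : Type*} [Field K] [AddCommGroup V] [Module K V]
    [AddCommGroup W] [Module K W] (f : V →ₗ[K] W) (φ : V →ₗ[K] K) {e : V} (hfe : f e = 0)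
    (hφe : φ e = 1) {θ : Submodule K V} (he : e ∈ θ) :
    Submodule.map f θ = Submodule.map f (θ ⊓ LinearMap.ker φ) := by
  apply le_antisymm
  · rintro _ ⟨x, hx, rfl⟩
    refine ⟨x - φ x • e, ⟨θ.sub_mem hx (θ.smul_mem _ he), ?_⟩, ?_⟩
    · simp [hφe]
    · simp [hfe]
  · exact Submodule.map_mono inf_le_left

theorem stmt13 (m : ℕ) (hm : 1 ≤ m)
    (θ : Submodule ℝ (Fin (m + 1) → ℝ)) (hθ : θ ∈ Theta (m + 1)) :
    -- if `e_h ∈ θ` then `U_h θ` agrees with both uniform formulas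
    ((Pi.single (Fin.last m) (1 : ℝ) : Fin (m + 1) → ℝ) ∈ θ →
      Submodule.map (Umap m) θ = Submodule.map (Umap m) (θ ⊓ kerLast m) ∧
      Submodule.map (Umap m) θ = Submodule.map (Umap m) (θ ⊓ kerOnes m)) ∧
    -- `P_{h,B}θ ∈ Θ_{h-1}` for `B ∈ F_1^{(h)}`
    Submodule.map (Umap m) (θ ⊓ kerLast m) ∈ Theta m ∧
    -- `P_{h,B}θ ∈ Θ_{h-1}` for `B ∈ F_2^{(h)}`
    Submodule.map (Umap m) (θ ⊓ kerOnes m) ∈ Theta m := by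
  have hUe : Umap m (Pi.single (Fin.last m) (1 : ℝ)) = 0 := by
    funext i
    simp [Umap, LinearMap.funLeft_apply, Fin.ext_iff, i.isLt.ne]
  refine ⟨fun he => ⟨?_, ?_⟩, ?_, ?_⟩
  · exact map_eq_map_inf_ker _ _ hUe (by simp) he
  · exact map_eq_map_inf_ker _ _ hUe (by simp [LinearMap.sum_apply]) he
  · refine map_Umap_inf_ker_mem_Theta _ (some (Fin.last m)) 0 ?_ hθ
    rintro (_ | k) hk
    · simp [vertexVec]
    · have hk' : Fin.last m ≠ k := fun h => hk (by rw [h])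
      simp [vertexVec, hk']
  · refine map_Umap_inf_ker_mem_Theta _ none 1 ?_ hθ
    rintro (_ | k) hk
    · exact absurd rfl hk
    · simp [vertexVec, LinearMap.sum_apply]
end
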